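/- For all exponents 1 < p₀, p₁, q₀, q₁ < ∞ there is a constant C such that for every sequence f = (f_k) of functions on 𝕋 admitting a decomposition f = a + b with a ∈ H^{p₀}(ℓ_{q₀}) and b ∈ H^{p₁}(ℓ_{q₁}), and for every t > 0, one has K_t(f; H^{p₀}(ℓ_{q₀}), H^{p₁}(ℓ_{q₁})) ≤ C·K_t(f; L^{p₀}(ℓ_{q₀}), L^{p₁}(ℓ_{q₁})). -/

import Mathlib

open MeasureTheory Real ENNReal NNReal

noncomputable section

instance : Fact (0 < 2 * Real.pi) := ⟨by positivity⟩

/-- The circle group `𝕋`, realized as `ℝ / 2πℤ`. -/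
abbrev 𝕋 : Type := AddCircle (2 * Real.pi)

/-- The normalized Haar measure on `𝕋`. -/
abbrev μ𝕋 : Measure 𝕋 := AddCircle.haarAddCircle

/-- The mixed norm `‖f‖_{L^p(ℓ_q)} = (∫ (∑_k |f_k|^q)^{p/q} dm)^{1/p}` of a sequence
`f = (f_k)` of functions on `𝕋`, valued in `ℝ≥0∞`. -/
def eLpLqNorm (p q : ℝ) (f : ℕ → 𝕋 → ℂ) : ℝ≥0∞ :=
  (∫⁻ t, ((∑' k, (‖f k t‖₊ : ℝ≥0∞) ^ q) ^ (1 / q)) ^ p ∂μ𝕋) ^ (1 / p)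

/-- `f = (f_k)` belongs to `L^p(ℓ_q)`. -/
def MemLpLq (p q : ℝ) (f : ℕ → 𝕋 → ℂ) : Prop :=
  (∀ k, AEStronglyMeasurable (f k) μ𝕋) ∧ eLpLqNorm p q f < ⊤

/-- `f = (f_k)` belongs to `H^p(ℓ_q)`: it belongs to `L^p(ℓ_q)` and every Fourier
coefficient `f̂_k(n)` with `n < 0` vanishes. -/
def MemHpLq (p q : ℝ) (f : ℕ → 𝕋 → ℂ) : Prop :=
  MemLpLq p q f ∧ ∀ k, ∀ n : ℤ, n < 0 → fourierCoeff (f k) n = 0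

/-- The K-functional `K_t(f; X₀, X₁)` for a couple of spaces of sequences of functions given
by membership predicates `X₀, X₁` and (quasi-)norms `N₀, N₁`:
`inf {N₀(g₀) + t N₁(g₁) : f = g₀ + g₁, g₀ ∈ X₀, g₁ ∈ X₁}`. -/
def Kfunctional (t : ℝ≥0∞) (X₀ X₁ : (ℕ → 𝕋 → ℂ) → Prop)
    (N₀ N₁ : (ℕ → 𝕋 → ℂ) → ℝ≥0∞) (f : ℕ → 𝕋 → ℂ) : ℝ≥0∞ :=
  ⨅ (g₀ : ℕ → 𝕋 → ℂ) (g₁ : ℕ → 𝕋 → ℂ) (_ : X₀ g₀) (_ : X₁ g₁) (_ : f = g₀ + g₁),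
    N₀ g₀ + t * N₁ g₁

theorem lintegral_rpow_mul_indicator {p b : ℝ} (hp : 0 < p) (hb : 0 ≤ b) :
    ∫⁻ l in Set.Ioi (0 : ℝ), ENNReal.ofReal (l ^ (p - 1)) * (if 2 * l < b then 1 else 0) =
      ENNReal.ofReal ((b / 2) ^ p / p) := by
  have h1 : ∀ l : ℝ, ENNReal.ofReal (l ^ (p - 1)) * (if 2 * l < b then 1 else 0) =
      (Set.Iio (b / 2)).indicator (fun l => ENNReal.ofReal (l ^ (p - 1))) l := by
    intro l
    by_cases h : 2 * l < b
    · have : l < b / 2 := by linarith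
      simp [h, this]
    · have : ¬ l < b / 2 := by intro h'; apply h; linarith
      simp [h, this]
  simp_rw [h1]
  rw [setLIntegral_indicator measurableSet_Iio, Set.Iio_inter_Ioi,
    ← ofReal_integral_eq_lintegral_ofReal]
  · rw [← integral_Ioc_eq_integral_Ioo, ← intervalIntegral.integral_of_le (by positivity),
      integral_rpow (Or.inl (by linarith))]
    simp [hp.ne']
  · refine IntegrableOn.mono_set ?_ Set.Ioo_subset_Ioc_self
    exact (intervalIntegrable_iff_integrableOn_Ioc_of_le (by positivity)).1
      (intervalIntegral.intervalIntegrable_rpow' (by linarith))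
  · filter_upwards [ae_restrict_mem measurableSet_Ioo] with l hl
    exact Real.rpow_nonneg hl.1.le _

theorem lintegral_rpow_mul_min_le {p s a : ℝ} (hp : 1 < p) (hs : p < s) (ha : 0 ≤ a) :
    ∫⁻ l in Set.Ioi (0 : ℝ),
        ENNReal.ofReal (l ^ (p - 1)) * ENNReal.ofReal (min (a / l) ((a / l) ^ s)) ≤
      ENNReal.ofReal ((1 / (p - 1) + 1 / (s - p)) * a ^ p) := by
  rcases ha.eq_or_lt with rfl | ha
  · simp
  have hI : Set.Ioi (0 : ℝ) = Set.Ioc 0 a ∪ Set.Ioi a := (Set.Ioc_union_Ioi_eq_Ioi ha.le).symm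
  rw [hI]
  refine (lintegral_union_le _ _ _).trans ?_
  have hA : ∫⁻ l in Set.Ioc (0 : ℝ) a,
        ENNReal.ofReal (l ^ (p - 1)) * ENNReal.ofReal (min (a / l) ((a / l) ^ s)) ≤
      ENNReal.ofReal (1 / (p - 1) * a ^ p) := by
    calc _ ≤ ∫⁻ l in Set.Ioc (0 : ℝ) a, ENNReal.ofReal (a * l ^ (p - 2)) := by
          refine setLIntegral_mono' measurableSet_Ioc fun l hl => ?_
          rw [← ENNReal.ofReal_mul (Real.rpow_nonneg hl.1.le _)]
          refine ENNReal.ofReal_le_ofReal ?_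
          calc _ ≤ l ^ (p - 1) * (a / l) :=
                mul_le_mul_of_nonneg_left (min_le_left _ _) (Real.rpow_nonneg hl.1.le _)
            _ = a * l ^ (p - 2) := by
                rw [show p - 1 = (p - 2) + 1 by ring, Real.rpow_add_one hl.1.ne']
                field_simp [hl.1.ne']
      _ = _ := by
          rw [← ofReal_integral_eq_lintegral_ofReal]
          · rw [← intervalIntegral.integral_of_le ha.le, intervalIntegral.integral_const_mul,
              integral_rpow (Or.inl (by linarith))]
            rw [show p - 2 + 1 = p - 1 by ring, Real.zero_rpow (by linarith)]
            congr 1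
            rw [show a ^ p = a ^ (p - 1) * a by
              rw [← Real.rpow_add_one ha.ne']; congr 1; ring]
            ring
          · refine Integrable.const_mul ?_ a
            exact (intervalIntegrable_iff_integrableOn_Ioc_of_le ha.le).1
              (intervalIntegral.intervalIntegrable_rpow' (by linarith))
          · filter_upwards [ae_restrict_mem measurableSet_Ioc] with l hl
            exact mul_nonneg ha.le (Real.rpow_nonneg hl.1.le _)
  have hB : ∫⁻ l in Set.Ioi a,
        ENNReal.ofReal (l ^ (p - 1)) * ENNReal.ofReal (min (a / l) ((a / l) ^ s)) ≤
      ENNReal.ofReal (1 / (s - p) * a ^ p) := by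
    calc _ ≤ ∫⁻ l in Set.Ioi a, ENNReal.ofReal (a ^ s * l ^ (p - 1 - s)) := by
          refine setLIntegral_mono' measurableSet_Ioi fun l hl => ?_
          have hl0 : 0 < l := ha.trans hl
          rw [← ENNReal.ofReal_mul (Real.rpow_nonneg hl0.le _)]
          refine ENNReal.ofReal_le_ofReal ?_
          calc _ ≤ l ^ (p - 1) * (a / l) ^ s :=
                mul_le_mul_of_nonneg_left (min_le_right _ _) (Real.rpow_nonneg hl0.le _)
            _ = _ := by
                rw [Real.div_rpow ha.le hl0.le, Real.rpow_sub hl0 (p - 1) s]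
                field_simp
      _ = _ := by
          rw [← ofReal_integral_eq_lintegral_ofReal]
          · rw [integral_const_mul, integral_Ioi_rpow_of_lt (by linarith) ha]
            congr 1
            rw [show p - 1 - s + 1 = p - s by ring, Real.rpow_sub ha]
            have : a ^ s ≠ 0 := (Real.rpow_pos_of_pos ha _).ne'
            have h2 : s - p ≠ 0 := by linarith
            have h3 : p - s ≠ 0 := by linarith
            field_simp
            ring
          · exact (integrableOn_Ioi_rpow_of_lt (by linarith) ha).const_mul _
          · filter_upwards [ae_restrict_mem measurableSet_Ioi] with l hl
            exact mul_nonneg (Real.rpow_nonneg ha.le _)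
              (Real.rpow_nonneg (ha.trans hl).le _)
  refine (add_le_add hA hB).trans ?_
  rw [← ENNReal.ofReal_add, add_mul]
  · have : 0 < p - 1 := by linarith
    positivity
  · have : 0 < s - p := by linarith
    positivity

/-- A distributional estimate `#{b > 2 * l} ≤ K ∑ min (a / l) ((a / l) ^ s)`, valid at every level
`l`, yields the corresponding `ℓ^p` bound for `1 < p < s`. -/
theorem sum_rpow_le_of_card_le {p s : ℝ} (hp : 1 < p) (hs : p < s) :
    ∃ C : ℝ, 0 ≤ C ∧ ∀ (S : Finset ℕ) (a b : ℕ → ℝ) (K : ℝ), 0 ≤ K → (∀ i, 0 ≤ a i) →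
      (∀ i, 0 ≤ b i) →
      (∀ l : ℝ, 0 < l → ((S.filter fun i => 2 * l < b i).card : ℝ) ≤
        K * ∑ i ∈ S, min (a i / l) ((a i / l) ^ s)) →
      ∑ i ∈ S, b i ^ p ≤ C * K * ∑ i ∈ S, a i ^ p := by
  have hp0 : 0 < p := by linarith
  have hs1 : 0 < s - p := by linarith
  have hp1 : 0 < p - 1 := by linarith
  set c := 1 / (p - 1) + 1 / (s - p) with hc
  have hc0 : 0 ≤ c := by positivity
  refine ⟨2 ^ p * p * c, by positivity, fun S a b K hK ha hb h => ?_⟩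
  have hmin : ∀ i l, 0 < l → 0 ≤ min (a i / l) ((a i / l) ^ s) := fun i l hl =>
    le_min (div_nonneg (ha i) hl.le) (Real.rpow_nonneg (div_nonneg (ha i) hl.le) _)
  have key : ENNReal.ofReal (∑ i ∈ S, (b i / 2) ^ p / p) ≤
      ENNReal.ofReal (K * ∑ i ∈ S, c * a i ^ p) := by
    calc ENNReal.ofReal (∑ i ∈ S, (b i / 2) ^ p / p)
        = ∑ i ∈ S, ∫⁻ l in Set.Ioi (0 : ℝ),
            ENNReal.ofReal (l ^ (p - 1)) * (if 2 * l < b i then 1 else 0) := by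
          rw [ENNReal.ofReal_sum_of_nonneg]
          · exact Finset.sum_congr rfl fun i _ =>
              (lintegral_rpow_mul_indicator hp0 (hb i)).symm
          · intro i _; have := hb i; positivity
      _ = ∫⁻ l in Set.Ioi (0 : ℝ), ∑ i ∈ S,
            ENNReal.ofReal (l ^ (p - 1)) * (if 2 * l < b i then 1 else 0) := by
          rw [lintegral_finsetSum']
          intro i _
          refine Measurable.aemeasurable ?_
          refine Measurable.mul (by fun_prop) ?_
          exact Measurable.ite (measurableSet_lt (by fun_prop) (by fun_prop))
            measurable_const measurable_const
      _ ≤ ∫⁻ l in Set.Ioi (0 : ℝ), ENNReal.ofReal K * ∑ i ∈ S,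
            ENNReal.ofReal (l ^ (p - 1)) * ENNReal.ofReal (min (a i / l) ((a i / l) ^ s)) := by
          refine setLIntegral_mono' measurableSet_Ioi fun l hl => ?_
          rw [← Finset.mul_sum, ← Finset.mul_sum, mul_left_comm]
          gcongr
          rw [Finset.sum_ite, Finset.sum_const_zero, add_zero, Finset.sum_const, nsmul_one,
            ← ENNReal.ofReal_natCast, ← ENNReal.ofReal_sum_of_nonneg fun i _ => hmin i l hl,
            ← ENNReal.ofReal_mul hK]
          exact ENNReal.ofReal_le_ofReal (h l hl)
      _ = ENNReal.ofReal K * ∑ i ∈ S, ∫⁻ l in Set.Ioi (0 : ℝ),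
            ENNReal.ofReal (l ^ (p - 1)) * ENNReal.ofReal (min (a i / l) ((a i / l) ^ s)) := by
          rw [lintegral_const_mul' _ _ ENNReal.ofReal_ne_top, lintegral_finsetSum']
          intro i _
          exact Measurable.aemeasurable (by fun_prop)
      _ ≤ ENNReal.ofReal K * ∑ i ∈ S, ENNReal.ofReal (c * a i ^ p) := by
          gcongr with i _
          exact lintegral_rpow_mul_min_le hp hs (ha i)
      _ = _ := by
          rw [ENNReal.ofReal_mul hK, ENNReal.ofReal_sum_of_nonneg]
          intro i _; have := ha i; positivity
  have key' := (ENNReal.ofReal_le_ofReal_iff (by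
    refine mul_nonneg hK (Finset.sum_nonneg fun i _ => ?_)
    have := ha i; positivity)).1 key
  have e1 : ∑ i ∈ S, (b i / 2) ^ p / p = (∑ i ∈ S, b i ^ p) / (2 ^ p * p) := by
    rw [Finset.sum_div]
    refine Finset.sum_congr rfl fun i _ => ?_
    rw [Real.div_rpow (hb i) (by norm_num), div_div]
  rw [e1, div_le_iff₀ (by positivity), ← Finset.mul_sum] at key'
  calc _ ≤ _ := key'
    _ = _ := by ring

/-- The dyadic block of length `2 ^ m` of `{0, …, 2 ^ N - 1}` containing `i`. -/
def dyadicBlock (N m i : ℕ) : Finset ℕ :=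
  (Finset.range (2 ^ N)).filter fun j => j / 2 ^ m = i / 2 ^ m

/-- The average of `h` over the dyadic block of length `2 ^ m` containing `i`. -/
def dyadicAvg {E : Type*} [AddCommGroup E] [Module ℝ E] (N m : ℕ) (h : ℕ → E) (i : ℕ) : E :=
  ((2 : ℝ) ^ m)⁻¹ • ∑ j ∈ dyadicBlock N m i, h j

/-- The largest scale at which the average of `F` around `i` exceeds `l`, or `0`. -/
def stoppingScale (N : ℕ) (F : ℕ → ℝ) (l : ℝ) (i : ℕ) : ℕ :=
  open Classical in Nat.findGreatest (fun m => l < dyadicAvg N m F i) N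

/-- The dyadic maximal function. -/
def dyadicMax (N : ℕ) (F : ℕ → ℝ) (i : ℕ) : ℝ :=
  (Finset.range (N + 1)).sup' ⟨0, by simp⟩ fun m => dyadicAvg N m F i

theorem mem_dyadicBlock {N m i j : ℕ} :
    j ∈ dyadicBlock N m i ↔ j < 2 ^ N ∧ j / 2 ^ m = i / 2 ^ m := by
  simp [dyadicBlock]

theorem dyadicBlock_congr {N m i j : ℕ} (h : j / 2 ^ m = i / 2 ^ m) :
    dyadicBlock N m j = dyadicBlock N m i := by
  simp [dyadicBlock, h]

theorem div_two_pow_congr {m n i j : ℕ} (hmn : m ≤ n) (h : j / 2 ^ m = i / 2 ^ m) :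
    j / 2 ^ n = i / 2 ^ n := by
  obtain ⟨k, rfl⟩ := Nat.exists_eq_add_of_le hmn
  rw [pow_add, ← Nat.div_div_eq_div_mul, ← Nat.div_div_eq_div_mul, h]

theorem div_two_pow_lt {N m i : ℕ} (hm : m ≤ N) (hi : i < 2 ^ N) :
    (i / 2 ^ m + 1) * 2 ^ m ≤ 2 ^ N := by
  obtain ⟨k, rfl⟩ := Nat.exists_eq_add_of_le hm
  have : i / 2 ^ m < 2 ^ k := by
    rw [Nat.div_lt_iff_lt_mul (by positivity), mul_comm, ← pow_add]; exact hi
  rw [pow_add, mul_comm (2 ^ m) (2 ^ k)]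
  exact Nat.mul_le_mul_right _ this

theorem card_dyadicBlock {N m i : ℕ} (hm : m ≤ N) (hi : i < 2 ^ N) :
    (dyadicBlock N m i).card = 2 ^ m := by
  have h : dyadicBlock N m i = Finset.Ico (i / 2 ^ m * 2 ^ m) (i / 2 ^ m * 2 ^ m + 2 ^ m) := by
    ext j
    have h1 := div_two_pow_lt hm hi
    rw [mem_dyadicBlock, Finset.mem_Ico, Nat.div_eq_iff (by positivity)]
    have : 0 < 2 ^ m := by positivity
    rw [add_mul] at h1
    omega
  simp [h]

section Avg

variable {E : Type*} [NormedAddCommGroup E] [NormedSpace ℝ E]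

theorem dyadicAvg_congr {N m i j : ℕ} (h : ℕ → E) (hij : j / 2 ^ m = i / 2 ^ m) :
    dyadicAvg N m h j = dyadicAvg N m h i := by
  simp [dyadicAvg, dyadicBlock_congr hij]

theorem dyadicAvg_zero {N i : ℕ} (h : ℕ → E) (hi : i < 2 ^ N) : dyadicAvg N 0 h i = h i := by
  have : dyadicBlock N 0 i = {i} := by
    ext j; rw [mem_dyadicBlock]; simp; rintro rfl; exact hi
  simp [dyadicAvg, this]

theorem norm_dyadicAvg_le (N m : ℕ) (h : ℕ → E) (i : ℕ) :
    ‖dyadicAvg N m h i‖ ≤ dyadicAvg N m (fun j => ‖h j‖) i := by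
  rw [dyadicAvg, dyadicAvg, norm_smul, smul_eq_mul, norm_inv, norm_pow, Real.norm_ofNat]
  gcongr
  exact norm_sum_le _ _

theorem dyadicAvg_nonneg {F : ℕ → ℝ} (hF : ∀ i, 0 ≤ F i) (N m i : ℕ) :
    0 ≤ dyadicAvg N m F i :=
  smul_nonneg (by positivity) (Finset.sum_nonneg fun _ _ => hF _)

theorem dyadicAvg_le_two_mul {F : ℕ → ℝ} (hF : ∀ i, 0 ≤ F i) (N m i : ℕ) :
    dyadicAvg N m F i ≤ 2 * dyadicAvg N (m + 1) F i := by
  have hsub : dyadicBlock N m i ⊆ dyadicBlock N (m + 1) i := fun j hj => by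
    rw [mem_dyadicBlock] at hj ⊢
    exact ⟨hj.1, div_two_pow_congr (Nat.le_succ m) hj.2⟩
  have h2 : (2 : ℝ) * ((2 : ℝ) ^ (m + 1))⁻¹ = ((2 : ℝ) ^ m)⁻¹ := by
    rw [pow_succ]; field_simp
  rw [dyadicAvg, dyadicAvg, smul_eq_mul, smul_eq_mul, ← mul_assoc, h2]
  gcongr
  exact fun i _ _ => hF i

theorem dyadicAvg_le_dyadicMax (F : ℕ → ℝ) {N m : ℕ} (hm : m ≤ N) (i : ℕ) :
    dyadicAvg N m F i ≤ dyadicMax N F i :=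
  Finset.le_sup' (fun m => dyadicAvg N m F i) (Finset.mem_range.2 (Nat.lt_succ_of_le hm))

theorem le_dyadicMax (F : ℕ → ℝ) {N i : ℕ} (hi : i < 2 ^ N) : F i ≤ dyadicMax N F i := by
  have := dyadicAvg_le_dyadicMax F (Nat.zero_le N) i
  rwa [dyadicAvg_zero F hi] at this

theorem dyadicMax_nonneg {F : ℕ → ℝ} (hF : ∀ i, 0 ≤ F i) (N i : ℕ) : 0 ≤ dyadicMax N F i :=
  (dyadicAvg_nonneg hF N 0 i).trans (dyadicAvg_le_dyadicMax F (Nat.zero_le N) i)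

theorem stoppingScale_le (N : ℕ) (F : ℕ → ℝ) (l : ℝ) (i : ℕ) : stoppingScale N F l i ≤ N := by
  classical
  exact Nat.findGreatest_le N

theorem stoppingScale_congr {N : ℕ} {F : ℕ → ℝ} {l : ℝ} {i j : ℕ}
    (h : j / 2 ^ stoppingScale N F l i = i / 2 ^ stoppingScale N F l i) :
    stoppingScale N F l j = stoppingScale N F l i := by
  classical
  set t := stoppingScale N F l i with ht
  have hP : ∀ m, t ≤ m → dyadicAvg N m F j = dyadicAvg N m F i := fun m hm =>
    dyadicAvg_congr F (div_two_pow_congr hm h)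
  have h1 := (Nat.findGreatest_eq_iff (P := fun m => l < dyadicAvg N m F i)).1 ht.symm
  refine (Nat.findGreatest_eq_iff (P := fun m => l < dyadicAvg N m F j)).2
    ⟨h1.1, fun h0 => ?_, fun n hn hnN => ?_⟩
  · rw [hP t le_rfl]; exact h1.2.1 h0
  · rw [hP n hn.le]; exact h1.2.2 hn hnN

theorem dyadicAvg_le_of_stoppingScale_lt {N m : ℕ} {F : ℕ → ℝ} {l : ℝ} {i : ℕ}
    (hm : stoppingScale N F l i < m) (hmN : m ≤ N) : dyadicAvg N m F i ≤ l := by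
  classical
  exact not_lt.1 (Nat.findGreatest_is_greatest hm hmN)

theorem lt_dyadicAvg_stoppingScale {N : ℕ} {F : ℕ → ℝ} {l : ℝ} {i : ℕ}
    (h : l < dyadicMax N F i) : l < dyadicAvg N (stoppingScale N F l i) F i := by
  classical
  obtain ⟨m, hm, hlm⟩ := (Finset.lt_sup'_iff _).1 h
  exact Nat.findGreatest_spec (P := fun m => l < dyadicAvg N m F i)
    (Nat.lt_succ_iff.1 (Finset.mem_range.1 hm)) hlm

theorem lt_dyadicMax_iff {N : ℕ} {F : ℕ → ℝ} {l : ℝ} {i : ℕ} :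
    l < dyadicMax N F i ↔ l < dyadicAvg N (stoppingScale N F l i) F i :=
  ⟨lt_dyadicAvg_stoppingScale,
    fun h => h.trans_le (dyadicAvg_le_dyadicMax F (stoppingScale_le N F l i) i)⟩

theorem lt_dyadicMax_congr {N : ℕ} {F : ℕ → ℝ} {l : ℝ} {i j : ℕ}
    (h : j / 2 ^ stoppingScale N F l i = i / 2 ^ stoppingScale N F l i) :
    l < dyadicMax N F j ↔ l < dyadicMax N F i := by
  rw [lt_dyadicMax_iff, lt_dyadicMax_iff, stoppingScale_congr h, dyadicAvg_congr F h]

theorem stoppingScale_eq_zero {N : ℕ} {F : ℕ → ℝ} {l : ℝ} {i : ℕ}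
    (h : ¬ l < dyadicMax N F i) : stoppingScale N F l i = 0 := by
  classical
  by_contra h0
  exact h (lt_dyadicMax_iff.2 (Nat.findGreatest_of_ne_zero
    (P := fun m => l < dyadicAvg N m F i) rfl h0))

/-- The average of `h` over the stopping block of `i`. -/
def stoppedAvg (N : ℕ) (F : ℕ → ℝ) (l : ℝ) (h : ℕ → E) (i : ℕ) : E :=
  dyadicAvg N (stoppingScale N F l i) h i

/-- Averaging over stopping blocks preserves sums against functions constant on these blocks. -/
theorem sum_smul_stoppedAvg {𝕜 : Type*} [RCLike 𝕜] [NormedSpace 𝕜 E] [SMulCommClass 𝕜 ℝ E]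
    (N : ℕ) (F : ℕ → ℝ) (l : ℝ) (h : ℕ → E) (c : ℕ → 𝕜)
    (hc : ∀ i j, j / 2 ^ stoppingScale N F l i = i / 2 ^ stoppingScale N F l i → c j = c i) :
    ∑ i ∈ Finset.range (2 ^ N), c i • stoppedAvg N F l h i =
      ∑ i ∈ Finset.range (2 ^ N), c i • h i := by
  set t := stoppingScale N F l with ht
  have hsymm : ∀ i j, j / 2 ^ t i = i / 2 ^ t i → i / 2 ^ t j = j / 2 ^ t j := by
    intro i j hij
    have : t j = t i := stoppingScale_congr hij
    rw [this]; exact hij.symm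
  calc ∑ i ∈ Finset.range (2 ^ N), c i • stoppedAvg N F l h i
      = ∑ i ∈ Finset.range (2 ^ N), ∑ j ∈ Finset.range (2 ^ N),
          if j / 2 ^ t i = i / 2 ^ t i then c i • ((2 : ℝ) ^ t i)⁻¹ • h j else 0 := by
        refine Finset.sum_congr rfl fun i _ => ?_
        rw [stoppedAvg, dyadicAvg, Finset.smul_sum, Finset.smul_sum, dyadicBlock,
          Finset.sum_filter]
    _ = ∑ j ∈ Finset.range (2 ^ N), ∑ i ∈ Finset.range (2 ^ N),
          if i / 2 ^ t j = j / 2 ^ t j then c j • ((2 : ℝ) ^ t j)⁻¹ • h j else 0 := by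
        rw [Finset.sum_comm]
        refine Finset.sum_congr rfl fun j _ => Finset.sum_congr rfl fun i _ => ?_
        by_cases hij : j / 2 ^ t i = i / 2 ^ t i
        · rw [if_pos hij, if_pos (hsymm _ _ hij), hc _ _ hij, ht, stoppingScale_congr hij]
        · rw [if_neg hij, if_neg fun h' => hij (hsymm _ _ h')]
    _ = _ := by
        refine Finset.sum_congr rfl fun j hj => ?_
        rw [← Finset.sum_filter, ← dyadicBlock, Finset.sum_const,
          card_dyadicBlock (stoppingScale_le N F l j) (Finset.mem_range.1 hj), smul_comm (c j),
          ← Nat.cast_smul_eq_nsmul ℝ, smul_smul, ht]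
        simp

end Avg

/-- Weak type `(1, 1)` bound for the dyadic maximal function. -/
theorem mul_card_dyadicMax_le {F : ℕ → ℝ} (hF : ∀ i, 0 ≤ F i) (N : ℕ) (l : ℝ) :
    l * (((Finset.range (2 ^ N)).filter fun i => l < dyadicMax N F i).card : ℝ) ≤
      ∑ i ∈ Finset.range (2 ^ N), F i := by
  have h := sum_smul_stoppedAvg N F l F (fun i => if l < dyadicMax N F i then (1 : ℝ) else 0)
    (fun i j hij => by simp only [lt_dyadicMax_congr hij])
  calc l * (((Finset.range (2 ^ N)).filter fun i => l < dyadicMax N F i).card : ℝ)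
      = ∑ i ∈ Finset.range (2 ^ N), (if l < dyadicMax N F i then (1 : ℝ) else 0) • l := by
        rw [← Finset.sum_smul, Finset.sum_boole, smul_eq_mul, mul_comm]
    _ ≤ ∑ i ∈ Finset.range (2 ^ N),
          (if l < dyadicMax N F i then (1 : ℝ) else 0) • stoppedAvg N F l F i := by
        refine Finset.sum_le_sum fun i _ => ?_
        split_ifs with hi
        · simpa [stoppedAvg] using (lt_dyadicAvg_stoppingScale hi).le
        · simp
    _ ≤ _ := by
        rw [h]
        refine Finset.sum_le_sum fun i _ => ?_
        split_ifs
        · simp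
        · simpa using hF i

theorem min_rpow_of_one_le {x s : ℝ} (hs : 1 ≤ s) (hx : 1 ≤ x) : min x (x ^ s) = x :=
  min_eq_left (Real.self_le_rpow_of_one_le hx hs)

theorem min_rpow_of_le_one {x s : ℝ} (hs : 1 ≤ s) (hx0 : 0 ≤ x) (hx : x ≤ 1) :
    min x (x ^ s) = x ^ s :=
  min_eq_right (Real.rpow_le_self_of_le_one hx0 hx hs)

/-- The dyadic maximal function is bounded on `ℓ^p`, `1 < p < ∞`. -/
theorem exists_sum_dyadicMax_rpow_le {p : ℝ} (hp : 1 < p) :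
    ∃ C : ℝ, 0 ≤ C ∧ ∀ (N : ℕ) (F : ℕ → ℝ), (∀ i, 0 ≤ F i) →
      ∑ i ∈ Finset.range (2 ^ N), dyadicMax N F i ^ p ≤
        C * ∑ i ∈ Finset.range (2 ^ N), F i ^ p := by
  obtain ⟨C, hC, h⟩ := sum_rpow_le_of_card_le hp (lt_add_one p)
  refine ⟨C, hC, fun N F hF => ?_⟩
  have := h (Finset.range (2 ^ N)) F (dyadicMax N F) 1 zero_le_one hF
    (dyadicMax_nonneg hF N) fun l hl => ?_
  · simpa using this
  set G : ℕ → ℝ := fun i => if l < F i then F i else 0 with hG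
  have hG0 : ∀ i, 0 ≤ G i := fun i => by simp only [hG]; split_ifs; exacts [hF i, le_rfl]
  have hmax : ∀ i ∈ Finset.range (2 ^ N), 2 * l < dyadicMax N F i → l < dyadicMax N G i := by
    intro i hi h2
    obtain ⟨m, hm, hlm⟩ := (Finset.lt_sup'_iff _).1 h2
    have hm' : m ≤ N := Nat.lt_succ_iff.1 (Finset.mem_range.1 hm)
    refine lt_of_lt_of_le ?_ (dyadicAvg_le_dyadicMax G hm' i)
    have h3 : dyadicAvg N m F i ≤ dyadicAvg N m G i + l := by
      have hcard := card_dyadicBlock hm' (Finset.mem_range.1 hi)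
      calc dyadicAvg N m F i ≤ ((2 : ℝ) ^ m)⁻¹ • ∑ j ∈ dyadicBlock N m i, (G j + l) := by
            rw [dyadicAvg]
            gcongr with j _
            simp only [hG]
            split_ifs with hj
            · linarith
            · linarith
        _ = _ := by
            rw [Finset.sum_add_distrib, smul_add, Finset.sum_const, hcard, dyadicAvg]
            simp
    linarith
  have hw := mul_card_dyadicMax_le hG0 N l
  rw [one_mul]
  calc (((Finset.range (2 ^ N)).filter fun i => 2 * l < dyadicMax N F i).card : ℝ)
      ≤ (((Finset.range (2 ^ N)).filter fun i => l < dyadicMax N G i).card : ℝ) := by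
        refine Nat.cast_le.2 (Finset.card_le_card fun i hi => ?_)
        rw [Finset.mem_filter] at hi ⊢
        exact ⟨hi.1, hmax i hi.1 hi.2⟩
    _ ≤ (∑ i ∈ Finset.range (2 ^ N), G i) / l := by
        rw [le_div_iff₀ hl, mul_comm]; exact hw
    _ ≤ _ := by
        rw [Finset.sum_div]
        refine Finset.sum_le_sum fun i _ => ?_
        simp only [hG]
        split_ifs with hi
        · rw [min_rpow_of_one_le (by linarith) ((one_le_div hl).2 hi.le)]
        · rw [zero_div]
          have := hF i
          positivity

/-- The operator with matrix `k` acting on the first `2 ^ N` entries of `f`. -/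
def kernelSum {E : Type*} [AddCommGroup E] [Module ℂ E] (N : ℕ) (k : ℕ → ℕ → ℂ) (f : ℕ → E)
    (i : ℕ) : E :=
  ∑ j ∈ Finset.range (2 ^ N), k i j • f j

/-- `i` lies neither in the dyadic block of length `2 ^ m` containing `j` nor, cyclically modulo
`2 ^ N`, in one of its two neighbours. -/
def FarFromBlock (N m i j : ℕ) : Prop :=
  ∀ j' < 2 ^ N, j' / 2 ^ m = j / 2 ^ m →
    i ≠ j' ∧ i ≠ (j' + 2 ^ m) % 2 ^ N ∧ i ≠ (j' + (2 ^ N - 2 ^ m)) % 2 ^ N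

/-- Hörmander's condition for the matrix `k`, relative to the dyadic blocks. -/
def HormanderBound (N : ℕ) (k : ℕ → ℕ → ℂ) (A : ℝ) : Prop :=
  open Classical in ∀ m < N, ∀ j < 2 ^ N,
    ∑ i ∈ (Finset.range (2 ^ N)).filter (fun i => FarFromBlock N m i j),
      ‖k i j - k i (j / 2 ^ m * 2 ^ m)‖ ≤ A

section

variable {E : Type*} [NormedAddCommGroup E] [NormedSpace ℂ E]

theorem kernelSum_add (N : ℕ) (k : ℕ → ℕ → ℂ) (f g : ℕ → E) (i : ℕ) :
    kernelSum N k (f + g) i = kernelSum N k f i + kernelSum N k g i := by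
  simp [kernelSum, smul_add, Finset.sum_add_distrib]

theorem mul_card_lt_le_sum {S : Finset ℕ} {b : ℕ → ℝ} (hb : ∀ i, 0 ≤ b i) {l : ℝ} :
    l * ((S.filter fun i => l < b i).card : ℝ) ≤ ∑ i ∈ S, b i := by
  calc l * ((S.filter fun i => l < b i).card : ℝ) = ∑ i ∈ S.filter (fun i => l < b i), l := by
        rw [Finset.sum_const, nsmul_eq_mul, mul_comm]
    _ ≤ ∑ i ∈ S.filter (fun i => l < b i), b i :=
        Finset.sum_le_sum fun i hi => (Finset.mem_filter.1 hi).2.le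
    _ ≤ _ := Finset.sum_le_sum_of_subset_of_nonneg (Finset.filter_subset _ _) fun i _ _ => hb i

/-- The Calderón–Zygmund estimate at level `l`. -/
theorem card_lt_norm_kernelSum_le {s A B : ℝ} (hs : 1 < s) (hA : 0 ≤ A) (hB : 0 ≤ B) {N : ℕ}
    {k : ℕ → ℕ → ℂ} (hk : HormanderBound N k A)
    (hT : ∀ f : ℕ → E, ∑ i ∈ Finset.range (2 ^ N), ‖kernelSum N k f i‖ ^ s ≤
      B * ∑ i ∈ Finset.range (2 ^ N), ‖f i‖ ^ s) (f : ℕ → E) {l : ℝ} (hl : 0 < l) :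
    (((Finset.range (2 ^ N)).filter fun i => 2 * l < ‖kernelSum N k f i‖).card : ℝ) ≤
      (B * 2 ^ s + 3 * A + 3) * ∑ i ∈ Finset.range (2 ^ N),
        min (dyadicMax N (fun i => ‖f i‖) i / l) ((dyadicMax N (fun i => ‖f i‖) i / l) ^ s) := by
  classical
  set R := Finset.range (2 ^ N) with hR
  set F : ℕ → ℝ := fun i => ‖f i‖ with hF
  have hF0 : ∀ i, 0 ≤ F i := fun i => norm_nonneg _
  set a := dyadicMax N F with ha
  have ha0 : ∀ i, 0 ≤ a i := dyadicMax_nonneg hF0 N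
  set φ : ℕ → ℝ := fun i => min (a i / l) ((a i / l) ^ s) with hφ
  have hφ0 : ∀ i, 0 ≤ φ i := fun i =>
    le_min (div_nonneg (ha0 i) hl.le) (Real.rpow_nonneg (div_nonneg (ha0 i) hl.le) _)
  set Ω := R.filter fun i => l < a i with hΩ
  have hφΩ : ∀ i, l < a i → φ i = a i / l := fun i hi =>
    min_rpow_of_one_le hs.le ((one_le_div hl).2 hi.le)
  have hφΩ' : ∀ i, ¬ l < a i → φ i = (a i / l) ^ s := fun i hi =>
    min_rpow_of_le_one hs.le (div_nonneg (ha0 i) hl.le) ((div_le_one hl).2 (not_lt.1 hi))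
  have hsumφ0 : 0 ≤ ∑ i ∈ R, φ i := Finset.sum_nonneg fun i _ => hφ0 i
  have hsumΩ : ∑ i ∈ Ω, a i / l ≤ ∑ i ∈ R, φ i := by
    calc ∑ i ∈ Ω, a i / l = ∑ i ∈ Ω, φ i :=
          Finset.sum_congr rfl fun i hi => (hφΩ i (Finset.mem_filter.1 hi).2).symm
      _ ≤ _ := Finset.sum_le_sum_of_subset_of_nonneg (Finset.filter_subset _ _)
          fun i _ _ => hφ0 i
  have hcardΩ : (Ω.card : ℝ) ≤ ∑ i ∈ R, φ i := by
    refine le_trans ?_ hsumΩ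
    rw [← nsmul_one, ← Finset.sum_const]
    exact Finset.sum_le_sum fun i hi => (one_le_div hl).2 (Finset.mem_filter.1 hi).2.le
  set t := stoppingScale N F l with ht
  have hcoef : 0 ≤ B * 2 ^ s := mul_nonneg hB (Real.rpow_nonneg (by norm_num) _)
  by_cases htop : ∃ i ∈ Ω, t i = N
  · obtain ⟨i, hi, hiN⟩ := htop
    have hall : R ⊆ Ω := fun j hj => by
      refine Finset.mem_filter.2 ⟨hj, ?_⟩
      refine (lt_dyadicMax_congr (i := i) ?_).2 (Finset.mem_filter.1 hi).2
      rw [← ht, hiN, Nat.div_eq_of_lt (Finset.mem_range.1 hj),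
        Nat.div_eq_of_lt (Finset.mem_range.1 (Finset.mem_filter.1 hi).1)]
    calc ((R.filter fun i => 2 * l < ‖kernelSum N k f i‖).card : ℝ) ≤ Ω.card :=
          Nat.cast_le.2 (Finset.card_le_card ((Finset.filter_subset _ _).trans hall))
      _ ≤ 1 * ∑ i ∈ R, φ i := by rwa [one_mul]
      _ ≤ _ := mul_le_mul_of_nonneg_right (by linarith) hsumφ0
  push Not at htop
  have htN : ∀ i ∈ Ω, t i < N := fun i hi =>
    lt_of_le_of_ne (stoppingScale_le N F l i) (htop i hi)
  set g := stoppedAvg N F l f with hg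
  set b := f - g with hb
  have hfgb : f = g + b := by simp [hb]
  -- bounds on the good part
  have hgF : ∀ i, ‖g i‖ ≤ dyadicAvg N (t i) F i := fun i => norm_dyadicAvg_le N _ f i
  have hgΩ : ∀ i ∈ Ω, ‖g i‖ ≤ 2 * l := fun i hi => by
    refine (hgF i).trans ((dyadicAvg_le_two_mul hF0 N _ i).trans ?_)
    have := dyadicAvg_le_of_stoppingScale_lt (N := N) (F := F) (l := l) (i := i)
      (Nat.lt_succ_self _) (htN i hi)
    simp only [ht] at *
    linarith
  have hgeq : ∀ i ∈ R, ¬ l < a i → g i = f i := fun i hi hia => by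
    rw [hg, stoppedAvg, stoppingScale_eq_zero hia, dyadicAvg_zero f (Finset.mem_range.1 hi)]
  have hFa : ∀ i ∈ R, F i ≤ a i := fun i hi => le_dyadicMax F (Finset.mem_range.1 hi)
  have hgφ : ∀ i ∈ R, ‖g i‖ ^ s ≤ l ^ s * (2 ^ s * φ i) := by
    intro i hi
    have h2s : (1 : ℝ) ≤ 2 ^ s := Real.one_le_rpow (by norm_num) (by linarith)
    by_cases hia : l < a i
    · calc ‖g i‖ ^ s ≤ (2 * l) ^ s :=
            Real.rpow_le_rpow (norm_nonneg _) (hgΩ i (Finset.mem_filter.2 ⟨hi, hia⟩))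
              (by linarith)
        _ = l ^ s * (2 ^ s * 1) := by rw [Real.mul_rpow (by norm_num) hl.le]; ring
        _ ≤ _ := by
          gcongr
          rw [hφΩ i hia]
          exact (one_le_div hl).2 hia.le
    · rw [hgeq i hi hia, hφΩ' i hia, Real.div_rpow (ha0 i) hl.le]
      have hls : 0 < l ^ s := Real.rpow_pos_of_pos hl _
      calc ‖f i‖ ^ s ≤ a i ^ s :=
            Real.rpow_le_rpow (norm_nonneg _) (hFa i hi) (by linarith)
        _ ≤ 2 ^ s * a i ^ s :=
            le_mul_of_one_le_left (Real.rpow_nonneg (ha0 i) _) h2s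
        _ = _ := by field_simp
  have hgood : ((R.filter fun i => l < ‖kernelSum N k g i‖).card : ℝ) ≤
      B * 2 ^ s * ∑ i ∈ R, φ i := by
    have hls : 0 < l ^ s := Real.rpow_pos_of_pos hl _
    have h1 : l ^ s * ((R.filter fun i => l < ‖kernelSum N k g i‖).card : ℝ) ≤
        ∑ i ∈ R, ‖kernelSum N k g i‖ ^ s := by
      refine le_trans ?_ (mul_card_lt_le_sum (S := R) (l := l ^ s)
        (b := fun i => ‖kernelSum N k g i‖ ^ s) fun i => Real.rpow_nonneg (norm_nonneg _) _)
      refine mul_le_mul_of_nonneg_left (Nat.cast_le.2 (Finset.card_le_card fun i hi => ?_)) hls.le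
      rw [Finset.mem_filter] at hi ⊢
      exact ⟨hi.1, Real.rpow_lt_rpow hl.le hi.2 (by linarith)⟩
    have h2 : l ^ s * ((R.filter fun i => l < ‖kernelSum N k g i‖).card : ℝ) ≤
        l ^ s * (B * 2 ^ s * ∑ i ∈ R, φ i) := by
      refine h1.trans ((hT g).trans ?_)
      calc B * ∑ i ∈ R, ‖g i‖ ^ s ≤ B * ∑ i ∈ R, l ^ s * (2 ^ s * φ i) := by
            gcongr with i hi; exact hgφ i hi
        _ = _ := by rw [← Finset.mul_sum, ← Finset.mul_sum]; ring
    exact le_of_mul_le_mul_left h2 hls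
  -- the bad part, away from the enlarged stopping blocks
  set Ω' := Ω ∪ Ω.image (fun i => (i + 2 ^ t i) % 2 ^ N) ∪
    Ω.image (fun i => (i + (2 ^ N - 2 ^ t i)) % 2 ^ N) with hΩ'
  have hcardΩ' : (Ω'.card : ℝ) ≤ 3 * ∑ i ∈ R, φ i := by
    have h3 : Ω'.card ≤ 3 * Ω.card := by
      have h4 := Finset.card_union_le (Ω ∪ Ω.image (fun i => (i + 2 ^ t i) % 2 ^ N))
        (Ω.image (fun i => (i + (2 ^ N - 2 ^ t i)) % 2 ^ N))
      have h5 := Finset.card_union_le Ω (Ω.image (fun i => (i + 2 ^ t i) % 2 ^ N))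
      have h6 := Finset.card_image_le (s := Ω) (f := fun i => (i + 2 ^ t i) % 2 ^ N)
      have h7 := Finset.card_image_le (s := Ω) (f := fun i => (i + (2 ^ N - 2 ^ t i)) % 2 ^ N)
      rw [← hΩ'] at h4
      omega
    have h4 : (Ω'.card : ℝ) ≤ 3 * Ω.card := by exact_mod_cast h3
    linarith
  have hfar : ∀ i, i ∉ Ω' → ∀ j ∈ Ω, FarFromBlock N (t j) i j := by
    intro i hi j hj j' hj' hjj
    have hj'Ω : j' ∈ Ω := Finset.mem_filter.2 ⟨Finset.mem_range.2 hj',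
      (lt_dyadicMax_congr hjj).2 (Finset.mem_filter.1 hj).2⟩
    have htj : t j' = t j := stoppingScale_congr hjj
    refine ⟨?_, ?_, ?_⟩
    · rintro rfl
      exact hi (by simp [hΩ', hj'Ω])
    · rintro rfl
      refine hi ?_
      rw [← htj]
      exact Finset.mem_union_left _ (Finset.mem_union_right _
        (Finset.mem_image_of_mem (fun i => (i + 2 ^ t i) % 2 ^ N) hj'Ω))
    · rintro rfl
      refine hi ?_
      rw [← htj]
      exact Finset.mem_union_right _
        (Finset.mem_image_of_mem (fun i => (i + (2 ^ N - 2 ^ t i)) % 2 ^ N) hj'Ω)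
  have hbΩ : ∀ j ∈ Ω, ‖b j‖ ≤ 3 * a j := fun j hj => by
    have h1 := hgΩ j hj
    have h2 := hFa j (Finset.mem_filter.1 hj).1
    have h3 := (Finset.mem_filter.1 hj).2
    calc ‖b j‖ ≤ ‖f j‖ + ‖g j‖ := norm_sub_le _ _
      _ ≤ a j + 2 * l := add_le_add h2 h1
      _ ≤ _ := by linarith
  have hTb : ∀ i, kernelSum N k b i =
      ∑ j ∈ Ω, (k i j - k i (j / 2 ^ t j * 2 ^ t j)) • b j := by
    intro i
    have hz : ∑ j ∈ R, k i (j / 2 ^ t j * 2 ^ t j) • b j = 0 := by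
      simp only [hb, Pi.sub_apply, smul_sub, Finset.sum_sub_distrib]
      rw [hg, sum_smul_stoppedAvg N F l f fun j => k i (j / 2 ^ t j * 2 ^ t j), sub_self]
      intro j j' hjj
      have htj : t j' = t j := stoppingScale_congr hjj
      simp only [htj]
      rw [hjj]
    rw [Finset.sum_filter_of_ne]
    · simp only [sub_smul, Finset.sum_sub_distrib]
      rw [hz, sub_zero, kernelSum]
    · intro j hj hne
      by_contra hja
      refine hne ?_
      simp [hb, hgeq j hj hja]
  have hbad : ((R.filter fun i => i ∉ Ω' ∧ l < ‖kernelSum N k b i‖).card : ℝ) ≤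
      3 * A * ∑ i ∈ R, φ i := by
    have h1 := mul_card_lt_le_sum (S := R.filter (fun i => i ∉ Ω')) (l := l)
      (b := fun i => ‖kernelSum N k b i‖) fun i => norm_nonneg _
    rw [Finset.filter_filter] at h1
    have h2 : ∑ i ∈ R.filter (fun i => i ∉ Ω'), ‖kernelSum N k b i‖ ≤
        l * (3 * A * ∑ i ∈ R, φ i) := by
      calc ∑ i ∈ R.filter (fun i => i ∉ Ω'), ‖kernelSum N k b i‖
          ≤ ∑ i ∈ R.filter (fun i => i ∉ Ω'), ∑ j ∈ Ω,
              ‖k i j - k i (j / 2 ^ t j * 2 ^ t j)‖ * ‖b j‖ := by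
            refine Finset.sum_le_sum fun i _ => ?_
            rw [hTb i]
            refine (norm_sum_le _ _).trans (Finset.sum_le_sum fun j _ => ?_)
            rw [norm_smul]
        _ = ∑ j ∈ Ω, (∑ i ∈ R.filter (fun i => i ∉ Ω'),
              ‖k i j - k i (j / 2 ^ t j * 2 ^ t j)‖) * ‖b j‖ := by
            rw [Finset.sum_comm]
            exact Finset.sum_congr rfl fun j _ => (Finset.sum_mul _ _ _).symm
        _ ≤ ∑ j ∈ Ω, A * (3 * a j) := by
            refine Finset.sum_le_sum fun j hj => ?_
            refine mul_le_mul ?_ (hbΩ j hj) (norm_nonneg _) hA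
            refine le_trans (Finset.sum_le_sum_of_subset_of_nonneg ?_ fun _ _ _ => norm_nonneg _)
              (hk (t j) (htN j hj) j (Finset.mem_range.1 (Finset.mem_filter.1 hj).1))
            intro i hi
            rw [Finset.mem_filter] at hi ⊢
            exact ⟨hi.1, hfar i hi.2 j hj⟩
        _ = l * (3 * A * ∑ j ∈ Ω, a j / l) := by
            rw [Finset.mul_sum, Finset.mul_sum]
            refine Finset.sum_congr rfl fun j _ => ?_
            field_simp
        _ ≤ _ := by gcongr
    exact le_of_mul_le_mul_left (h1.trans h2) hl
  have hunion : R.filter (fun i => 2 * l < ‖kernelSum N k f i‖) ⊆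
      R.filter (fun i => l < ‖kernelSum N k g i‖) ∪
        R.filter (fun i => i ∉ Ω' ∧ l < ‖kernelSum N k b i‖) ∪ Ω' := by
    intro i hi
    rw [Finset.mem_filter] at hi
    by_cases h1 : l < ‖kernelSum N k g i‖
    · exact Finset.mem_union_left _ (Finset.mem_union_left _ (Finset.mem_filter.2 ⟨hi.1, h1⟩))
    by_cases h2 : i ∈ Ω'
    · exact Finset.mem_union_right _ h2
    refine Finset.mem_union_left _ (Finset.mem_union_right _
      (Finset.mem_filter.2 ⟨hi.1, h2, ?_⟩))
    have h3 := hi.2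
    rw [hfgb, kernelSum_add] at h3
    have := norm_add_le (kernelSum N k g i) (kernelSum N k b i)
    linarith
  have hcard := (Finset.card_le_card hunion).trans ((Finset.card_union_le _ _).trans
    (Nat.add_le_add_right (Finset.card_union_le _ _) _))
  have hcard' : ((R.filter fun i => 2 * l < ‖kernelSum N k f i‖).card : ℝ) ≤
      (R.filter fun i => l < ‖kernelSum N k g i‖).card +
        (R.filter fun i => i ∉ Ω' ∧ l < ‖kernelSum N k b i‖).card + Ω'.card := by
    exact_mod_cast hcard
  linarith

end

/-- Calderón–Zygmund extrapolation: a matrix satisfying Hörmander's condition and bounded on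
`ℓ^s(E)` is bounded on `ℓ^p(E)` for `1 < p < s`, uniformly in the size of the matrix. -/
theorem exists_sum_norm_kernelSum_rpow_le {p s A B : ℝ} (hp : 1 < p) (hps : p < s) (hA : 0 ≤ A)
    (hB : 0 ≤ B) :
    ∃ C : ℝ, 0 ≤ C ∧ ∀ (E : Type) [NormedAddCommGroup E] [NormedSpace ℂ E] (N : ℕ)
      (k : ℕ → ℕ → ℂ), HormanderBound N k A →
      (∀ f : ℕ → E, ∑ i ∈ Finset.range (2 ^ N), ‖kernelSum N k f i‖ ^ s ≤
        B * ∑ i ∈ Finset.range (2 ^ N), ‖f i‖ ^ s) →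
      ∀ f : ℕ → E, ∑ i ∈ Finset.range (2 ^ N), ‖kernelSum N k f i‖ ^ p ≤
        C * ∑ i ∈ Finset.range (2 ^ N), ‖f i‖ ^ p := by
  obtain ⟨C₁, hC₁, h₁⟩ := sum_rpow_le_of_card_le hp hps
  obtain ⟨C₂, hC₂, h₂⟩ := exists_sum_dyadicMax_rpow_le hp
  have hK : 0 ≤ B * 2 ^ s + 3 * A + 3 := by positivity
  refine ⟨C₁ * (B * 2 ^ s + 3 * A + 3) * C₂, by positivity, ?_⟩
  intro E _ _ N k hk hT f
  have h3 := h₁ (Finset.range (2 ^ N)) (dyadicMax N fun i => ‖f i‖)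
    (fun i => ‖kernelSum N k f i‖) _ hK (dyadicMax_nonneg (fun i => norm_nonneg _) N)
    (fun i => norm_nonneg _)
    (fun l hl => card_lt_norm_kernelSum_le (hp.trans hps) hA hB hk hT f hl)
  refine h3.trans ?_
  rw [mul_assoc (C₁ * _)]
  gcongr
  exact h₂ N _ fun i => norm_nonneg _

/-- The character `x ↦ exp (2πix / 2 ^ N)` of `ℤ`. -/
def rootExp (N : ℕ) (x : ℤ) : ℂ := Complex.exp (Complex.I * ((2 * π * x / 2 ^ N : ℝ) : ℂ))

/-- The circulant matrix of size `2 ^ N` with eigenvalue `r ^ n` at the `n`-th character,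
`0 ≤ n < 2 ^ N`: a regularized discrete Riesz projection. -/
def rieszKernel (N : ℕ) (r : ℝ) (i j : ℕ) : ℂ :=
  ((2 : ℂ) ^ N)⁻¹ * ∑ n ∈ Finset.range (2 ^ N), (r : ℂ) ^ n * rootExp N (n * (i - j))

theorem rootExp_add (N : ℕ) (x y : ℤ) : rootExp N (x + y) = rootExp N x * rootExp N y := by
  rw [rootExp, rootExp, rootExp, ← Complex.exp_add]
  congr 1
  push_cast
  ring

@[simp] theorem rootExp_zero (N : ℕ) : rootExp N 0 = 1 := by simp [rootExp]

theorem rootExp_natCast_mul (N : ℕ) (n : ℕ) (x : ℤ) : rootExp N (n * x) = rootExp N x ^ n := by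
  rw [rootExp, rootExp, ← Complex.exp_nat_mul]
  congr 1
  push_cast
  ring

@[simp] theorem norm_rootExp (N : ℕ) (x : ℤ) : ‖rootExp N x‖ = 1 := by
  rw [rootExp, Complex.norm_exp_I_mul_ofReal]

theorem rootExp_two_pow_mul (N : ℕ) (x : ℤ) : rootExp N (2 ^ N * x) = 1 := by
  rw [rootExp, Complex.exp_eq_one_iff]
  refine ⟨x, ?_⟩
  push_cast
  have : (2 : ℂ) ^ N ≠ 0 := pow_ne_zero _ two_ne_zero
  field_simp

theorem rootExp_pow_two_pow (N : ℕ) (x : ℤ) : rootExp N x ^ (2 ^ N) = 1 := by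
  rw [← rootExp_natCast_mul]
  exact_mod_cast rootExp_two_pow_mul N x

theorem rootExp_congr {N : ℕ} {x y : ℤ} (h : (2 : ℤ) ^ N ∣ x - y) :
    rootExp N x = rootExp N y := by
  obtain ⟨z, hz⟩ := h
  rw [show x = 2 ^ N * z + y by linarith, rootExp_add, rootExp_two_pow_mul, one_mul]

theorem conj_rootExp (N : ℕ) (x : ℤ) : starRingEnd ℂ (rootExp N x) = rootExp N (-x) := by
  rw [rootExp, rootExp, ← Complex.exp_conj]
  congr 1
  rw [map_mul, Complex.conj_I, Complex.conj_ofReal]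
  push_cast
  ring

theorem conj_rieszKernel (N : ℕ) (r : ℝ) (i j : ℕ) :
    starRingEnd ℂ (rieszKernel N r i j) = rieszKernel N r j i := by
  simp only [rieszKernel, map_mul, map_inv₀, map_pow, map_sum, conj_rootExp, Complex.conj_ofReal,
    map_ofNat]
  congr 1
  refine Finset.sum_congr rfl fun n _ => ?_
  congr 2
  ring

theorem norm_one_sub_rootExp_le (N : ℕ) (x : ℤ) :
    ‖1 - rootExp N x‖ ≤ 2 * π * |(x : ℝ)| / 2 ^ N := by
  rw [norm_sub_rev, rootExp]
  refine Real.norm_exp_I_mul_ofReal_sub_one_le.trans ?_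
  rw [Real.norm_eq_abs, abs_div, abs_mul, abs_of_pos Real.two_pi_pos,
    abs_of_pos (by positivity : (0 : ℝ) < 2 ^ N)]

theorem le_norm_one_sub_rootExp {N : ℕ} {x : ℤ} (h0 : 0 ≤ x) (h1 : x ≤ 2 ^ N) :
    4 * min (x : ℝ) (2 ^ N - x) / 2 ^ N ≤ ‖1 - rootExp N x‖ := by
  have hM : (0 : ℝ) < 2 ^ N := by positivity
  have h0' : (0 : ℝ) ≤ x := by exact_mod_cast h0
  have h1' : (x : ℝ) ≤ 2 ^ N := by exact_mod_cast h1
  rw [norm_sub_rev, rootExp, Complex.norm_exp_I_mul_ofReal_sub_one, norm_mul, Real.norm_ofNat]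
  have hs : 2 * min (x : ℝ) (2 ^ N - x) / 2 ^ N ≤ Real.sin (2 * π * x / 2 ^ N / 2) := by
    rcases le_total (x : ℝ) (2 ^ N - x) with h | h
    · rw [min_eq_left h]
      have := Real.mul_le_sin (x := 2 * π * x / 2 ^ N / 2) (by positivity) (by
        rw [div_div, div_le_div_iff₀ (by positivity) (by positivity)]
        nlinarith [Real.pi_pos])
      refine le_trans (le_of_eq ?_) this
      field_simp
    · rw [min_eq_right h, ← Real.sin_pi_sub]
      have e : π - 2 * π * x / 2 ^ N / 2 = π * (2 ^ N - x) / 2 ^ N := by field_simp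
      rw [e]
      have := Real.mul_le_sin (x := π * (2 ^ N - x) / 2 ^ N)
        (div_nonneg (mul_nonneg Real.pi_pos.le (by linarith)) hM.le) (by
        rw [div_le_div_iff₀ (by positivity) (by positivity)]
        nlinarith [Real.pi_pos])
      refine le_trans (le_of_eq ?_) this
      field_simp
  calc 4 * min (x : ℝ) (2 ^ N - x) / 2 ^ N = 2 * (2 * min (x : ℝ) (2 ^ N - x) / 2 ^ N) := by ring
    _ ≤ 2 * Real.sin (2 * π * x / 2 ^ N / 2) := by linarith
    _ ≤ _ := by
      gcongr
      exact Real.le_norm_self _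

theorem norm_one_sub_le_two_mul {r : ℝ} (h0 : 0 ≤ r) (h1 : r ≤ 1) {z : ℂ} (hz : ‖z‖ = 1) :
    ‖1 - z‖ ≤ 2 * ‖1 - r * z‖ := by
  have h2 : (1 : ℝ) - r ≤ ‖1 - r * z‖ := by
    have := norm_sub_norm_le (1 : ℂ) (r * z)
    rw [norm_one, norm_mul, hz, Complex.norm_real, Real.norm_of_nonneg h0, mul_one] at this
    exact this
  have h3 : ‖1 - z‖ ≤ ‖1 - r * z‖ + (1 - r) := by
    have : 1 - z = (1 - r * z) - (1 - r : ℝ) * z := by push_cast; ring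
    rw [this]
    refine (norm_sub_le _ _).trans ?_
    rw [norm_mul, hz, Complex.norm_real, Real.norm_of_nonneg (by linarith), mul_one]
  linarith

theorem rieszKernel_mul_one_sub (N : ℕ) (r : ℝ) (i j : ℕ) :
    rieszKernel N r i j * (1 - r * rootExp N (i - j)) =
      ((2 : ℂ) ^ N)⁻¹ * (1 - (r : ℂ) ^ 2 ^ N) := by
  have h : ∀ n ∈ Finset.range (2 ^ N), (r : ℂ) ^ n * rootExp N (n * (i - j)) =
      (r * rootExp N (i - j)) ^ n := fun n _ => by
    rw [rootExp_natCast_mul, mul_pow]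
  rw [rieszKernel, Finset.sum_congr rfl h, mul_assoc, geom_sum_mul_neg, mul_pow,
    rootExp_pow_two_pow, mul_one]

theorem norm_rieszKernel_sub_le {N : ℕ} {r : ℝ} (h0 : 0 ≤ r) (h1 : r ≤ 1) {i j c : ℕ}
    {d e : ℝ} (hd : 0 < d) (he : 0 < e)
    (hdj : 4 * d / 2 ^ N ≤ ‖1 - rootExp N (i - j)‖)
    (hec : 4 * e / 2 ^ N ≤ ‖1 - rootExp N (i - c)‖) :
    ‖rieszKernel N r i j - rieszKernel N r i c‖ ≤ π / 2 * |(j : ℝ) - c| / (d * e) := by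
  have hM : (0 : ℝ) < 2 ^ N := by positivity
  set z := rootExp N (i - j) with hz
  set w := rootExp N (i - c) with hw
  have hz2 := norm_one_sub_le_two_mul h0 h1 (norm_rootExp N (i - j))
  have hw2 := norm_one_sub_le_two_mul h0 h1 (norm_rootExp N (i - c))
  rw [← hz] at hz2
  rw [← hw] at hw2
  have hz3 : 2 * d / 2 ^ N ≤ ‖1 - r * z‖ := by
    have : 4 * d / 2 ^ N = 2 * (2 * d / 2 ^ N) := by ring
    linarith
  have hw3 : 2 * e / 2 ^ N ≤ ‖1 - r * w‖ := by
    have : 4 * e / 2 ^ N = 2 * (2 * e / 2 ^ N) := by ring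
    linarith
  have hzpos : 0 < ‖1 - r * z‖ := lt_of_lt_of_le (by positivity) hz3
  have hwpos : 0 < ‖1 - r * w‖ := lt_of_lt_of_le (by positivity) hw3
  have hzne : 1 - r * z ≠ 0 := norm_pos_iff.1 hzpos
  have hwne : 1 - r * w ≠ 0 := norm_pos_iff.1 hwpos
  have hkz := rieszKernel_mul_one_sub N r i j
  have hkw := rieszKernel_mul_one_sub N r i c
  rw [← hz] at hkz
  rw [← hw] at hkw
  have hdiff : (rieszKernel N r i j - rieszKernel N r i c) * ((1 - r * z) * (1 - r * w)) =
      ((2 : ℂ) ^ N)⁻¹ * (1 - (r : ℂ) ^ 2 ^ N) * (r * (z - w)) := by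
    linear_combination (1 - r * w) * hkz - (1 - r * z) * hkw
  have hzw : ‖z - w‖ ≤ 2 * π * |(j : ℝ) - c| / 2 ^ N := by
    have : z - w = z * (1 - rootExp N (j - c)) := by
      rw [mul_sub, mul_one, hz, ← rootExp_add, hw]
      congr 2
      ring
    rw [this, norm_mul, hz, norm_rootExp, one_mul]
    refine (norm_one_sub_rootExp_le N _).trans (le_of_eq ?_)
    push_cast
    rfl
  have hr : ‖(1 : ℂ) - (r : ℂ) ^ 2 ^ N‖ ≤ 1 := by
    rw [← Complex.ofReal_pow, ← Complex.ofReal_one, ← Complex.ofReal_sub, Complex.norm_real,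
      Real.norm_of_nonneg (sub_nonneg.2 (pow_le_one₀ h0 h1))]
    linarith [pow_nonneg h0 (2 ^ N)]
  have hnorm : ‖rieszKernel N r i j - rieszKernel N r i c‖ * (‖1 - r * z‖ * ‖1 - r * w‖) ≤
      (2 ^ N)⁻¹ * (2 * π * |(j : ℝ) - c| / 2 ^ N) := by
    rw [← norm_mul, ← norm_mul, hdiff, norm_mul, norm_mul, norm_mul, norm_inv, norm_pow,
      Complex.norm_ofNat, Complex.norm_real, Real.norm_of_nonneg h0]
    calc (2 ^ N : ℝ)⁻¹ * ‖(1 : ℂ) - (r : ℂ) ^ 2 ^ N‖ * (r * ‖z - w‖)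
        ≤ (2 ^ N : ℝ)⁻¹ * 1 * (1 * (2 * π * |(j : ℝ) - c| / 2 ^ N)) := by gcongr
      _ = _ := by ring
  have hlow : 2 * d / 2 ^ N * (2 * e / 2 ^ N) ≤ ‖1 - r * z‖ * ‖1 - r * w‖ := by gcongr
  have hfin : ‖rieszKernel N r i j - rieszKernel N r i c‖ * (2 * d / 2 ^ N * (2 * e / 2 ^ N)) ≤
      (2 ^ N)⁻¹ * (2 * π * |(j : ℝ) - c| / 2 ^ N) :=
    (mul_le_mul_of_nonneg_left hlow (norm_nonneg _)).trans hnorm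
  rw [← le_div_iff₀ (by positivity)] at hfin
  refine hfin.trans (le_of_eq ?_)
  field_simp

theorem hormanderBound_rieszKernel (N : ℕ) {r : ℝ} (h0 : 0 ≤ r) (h1 : r ≤ 1) :
    HormanderBound N (rieszKernel N r) (2 * π) := by
  classical
  intro m hm j hj
  set c := j / 2 ^ m * 2 ^ m with hc
  set M := 2 ^ N with hM
  set P := 2 ^ m with hP
  have hP0 : 0 < P := by positivity
  have hPM : 2 * P ≤ M := by
    rw [hP, hM, ← pow_succ']; exact Nat.pow_le_pow_right (by norm_num) hm
  have hcP : c + P ≤ M := by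
    have := div_two_pow_lt hm.le hj
    rwa [add_mul, one_mul] at this
  have hcj : c ≤ j := Nat.div_mul_le_self _ _
  have hjc : j < c + P := by
    rw [hc]; have := Nat.lt_div_mul_add (a := j) hP0; linarith
  have hblock : ∀ v < P, (c + v) / P = j / P := fun v hv => by
    rw [hc, add_comm, Nat.add_mul_div_right _ _ hP0, Nat.div_eq_of_lt hv, zero_add]
  -- the cyclic distance from `c`
  set u : ℕ → ℕ := fun i => (i + (M - c)) % M with hu
  have hu1 : ∀ i < M, (c ≤ i ∧ u i + c = i) ∨ (i < c ∧ u i + c = i + M) := by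
    intro i hi
    rcases le_or_gt c i with h | h
    · left
      refine ⟨h, ?_⟩
      have : i + (M - c) = (i - c) + M := by omega
      rw [hu]; simp only
      rw [this, Nat.add_mod_right, Nat.mod_eq_of_lt (by omega)]
      omega
    · right
      refine ⟨h, ?_⟩
      rw [hu]; simp only
      rw [Nat.mod_eq_of_lt (by omega)]
      omega
  have hufar : ∀ i < M, FarFromBlock N m i j → 2 * P ≤ u i ∧ u i < M - P := by
    intro i hi hfar
    have hfar' : ∀ v < P, i ≠ c + v ∧ i ≠ (c + v + P) % M ∧ i ≠ (c + v + (M - P)) % M :=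
      fun v hv => hfar (c + v) (by omega) (hblock v hv)
    rcases hu1 i hi with ⟨h, hi'⟩ | ⟨h, hi'⟩
    · constructor
      · by_contra hlt
        rcases lt_or_ge (u i) P with h2 | h2
        · exact (hfar' (u i) h2).1 (by omega)
        · refine (hfar' (u i - P) (by omega)).2.1 ?_
          rw [Nat.mod_eq_of_lt (by omega)]
          omega
      · by_contra hlt
        refine (hfar' (u i - (M - P)) (by omega)).2.2 ?_
        rw [Nat.mod_eq_of_lt (by omega)]
        omega
    · constructor
      · by_contra hlt
        rcases lt_or_ge (u i) P with h2 | h2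
        · omega
        · refine (hfar' (u i - P) (by omega)).2.1 ?_
          have : c + (u i - P) + P = i + M := by omega
          rw [this, Nat.add_mod_right, Nat.mod_eq_of_lt hi]
      · by_contra hlt
        refine (hfar' (u i - (M - P)) (by omega)).2.2 ?_
        have : c + (u i - (M - P)) + (M - P) = i + M := by omega
        rw [this, Nat.add_mod_right, Nat.mod_eq_of_lt hi]
  have hMR : ((M : ℕ) : ℝ) = 2 ^ N := by rw [hM]; push_cast; rfl
  have hMZ : ((M : ℕ) : ℤ) = 2 ^ N := by rw [hM]; push_cast; rfl
  set G : ℕ → ℝ := fun w => π * P * (((w : ℝ) ^ 2)⁻¹ + (((M - w : ℕ) : ℝ) ^ 2)⁻¹) with hG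
  have hterm : ∀ i ∈ (Finset.range M).filter (fun i => FarFromBlock N m i j),
      ‖rieszKernel N r i j - rieszKernel N r i c‖ ≤ G (u i) := by
    intro i hi
    rw [Finset.mem_filter, Finset.mem_range] at hi
    obtain ⟨hu2, hu3⟩ := hufar i hi.1 hi.2
    have hdvd : (2 : ℤ) ^ N ∣ ((i : ℤ) - c) - u i := by
      rw [← hMZ]
      rcases hu1 i hi.1 with ⟨_, h⟩ | ⟨_, h⟩
      · exact ⟨0, by have : (i : ℤ) = u i + c := by omega
                     rw [this]; ring⟩
      · exact ⟨-1, by have : (i : ℤ) = u i + c - M := by omega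
                      rw [this]; ring⟩
    have hdvd' : (2 : ℤ) ^ N ∣ ((i : ℤ) - j) - (u i - (j - c)) := by
      have : ((i : ℤ) - j) - (u i - (j - c)) = ((i : ℤ) - c) - u i := by ring
      rwa [this]
    have hw : ((M - u i : ℕ) : ℝ) = 2 ^ N - u i := by
      rw [Nat.cast_sub (by omega), hMR]
    set x : ℝ := ((u i : ℕ) : ℝ) with hx
    set y : ℝ := ((M - u i : ℕ) : ℝ) with hy
    set e := min x y with he
    have hx2 : (2 * P : ℝ) ≤ x := by rw [hx]; exact_mod_cast hu2
    have hy0 : (P : ℝ) < y := by rw [hy]; exact_mod_cast (by omega : P < M - u i)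
    have hPR : (0 : ℝ) < P := by exact_mod_cast hP0
    have he0 : 0 < e := lt_min (by linarith) (by linarith)
    have hjcR : (j : ℝ) - c < P := by
      have : (j : ℝ) < c + P := by exact_mod_cast hjc
      linarith
    have hcjR : (c : ℝ) ≤ j := by exact_mod_cast hcj
    have key := norm_rieszKernel_sub_le h0 h1 (i := i) (j := j) (c := c) (N := N)
      (d := e / 2) (e := e) (by positivity) he0 (by
        rw [rootExp_congr hdvd']
        refine le_trans ?_ (le_norm_one_sub_rootExp (by omega) (by rw [← hMZ]; omega))
        push_cast
        gcongr
        refine le_min ?_ ?_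
        · have := min_le_left x y
          linarith
        · have := min_le_right x y
          linarith) (by
        rw [rootExp_congr hdvd]
        refine le_trans ?_ (le_norm_one_sub_rootExp (by omega) (by rw [← hMZ]; omega))
        push_cast
        gcongr
        rw [he, hw])
    refine key.trans ?_
    have hsq : (e ^ 2)⁻¹ ≤ (x ^ 2)⁻¹ + (y ^ 2)⁻¹ := by
      rcases min_choice x y with h | h
      · rw [he, h]; linarith [inv_nonneg.2 (sq_nonneg y)]
      · rw [he, h]; linarith [inv_nonneg.2 (sq_nonneg x)]
    rw [abs_of_nonneg (by linarith)]
    calc π / 2 * ((j : ℝ) - c) / (e / 2 * e) ≤ π / 2 * P / (e / 2 * e) := by gcongr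
      _ = π * P * (e ^ 2)⁻¹ := by field_simp
      _ ≤ _ := by
        rw [hG]; simp only
        gcongr
  have huinj : Set.InjOn u ((Finset.range M).filter (fun i => FarFromBlock N m i j)) := by
    intro a ha b hb hab
    simp only [Finset.coe_filter, Finset.mem_range, Set.mem_ofPred_eq] at ha hb
    have h2 := hu1 a ha.1
    have h3 := hu1 b hb.1
    rw [hab] at h2
    omega
  have hG0 : ∀ w, 0 ≤ G w := fun w => by rw [hG]; positivity
  have hsumsq : ∑ w ∈ Finset.Ioc P M, ((w : ℝ) ^ 2)⁻¹ ≤ (P : ℝ)⁻¹ := by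
    refine (sum_Ioc_inv_sq_le_sub hP0.ne' (by omega)).trans ?_
    have : (0 : ℝ) ≤ (M : ℝ)⁻¹ := by positivity
    linarith
  have hrefl : ∑ w ∈ Finset.Ioo P (M - P), (((M - w : ℕ) : ℝ) ^ 2)⁻¹ =
      ∑ w ∈ Finset.Ioo P (M - P), ((w : ℝ) ^ 2)⁻¹ := by
    refine Finset.sum_nbij' (fun w => M - w) (fun w => M - w) ?_ ?_ ?_ ?_ ?_
    · intro w hw; rw [Finset.mem_Ioo] at *; omega
    · intro w hw; rw [Finset.mem_Ioo] at *; omega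
    · intro w hw; rw [Finset.mem_Ioo] at *; omega
    · intro w hw; rw [Finset.mem_Ioo] at *; omega
    · intro w _; rfl
  have hIoo : ∑ w ∈ Finset.Ioo P (M - P), ((w : ℝ) ^ 2)⁻¹ ≤ (P : ℝ)⁻¹ := by
    refine le_trans (Finset.sum_le_sum_of_subset_of_nonneg ?_ fun _ _ _ => by positivity) hsumsq
    intro w hw
    rw [Finset.mem_Ioo] at hw
    rw [Finset.mem_Ioc]
    omega
  calc ∑ i ∈ (Finset.range M).filter (fun i => FarFromBlock N m i j),
        ‖rieszKernel N r i j - rieszKernel N r i c‖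
      ≤ ∑ i ∈ (Finset.range M).filter (fun i => FarFromBlock N m i j), G (u i) :=
        Finset.sum_le_sum hterm
    _ = ∑ w ∈ ((Finset.range M).filter (fun i => FarFromBlock N m i j)).image u, G w :=
        (Finset.sum_image huinj).symm
    _ ≤ ∑ w ∈ Finset.Ioo P (M - P), G w := by
        refine Finset.sum_le_sum_of_subset_of_nonneg ?_ fun w _ _ => hG0 w
        intro w hw
        rw [Finset.mem_image] at hw
        obtain ⟨i, hi, rfl⟩ := hw
        rw [Finset.mem_filter, Finset.mem_range] at hi
        have := hufar i hi.1 hi.2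
        rw [Finset.mem_Ioo]
        omega
    _ ≤ π * P * ((P : ℝ)⁻¹ + (P : ℝ)⁻¹) := by
        rw [hG, ← Finset.mul_sum, Finset.sum_add_distrib, hrefl]
        gcongr
    _ = 2 * π := by
        have : (P : ℝ) ≠ 0 := by exact_mod_cast hP0.ne'
        field_simp
        ring

theorem rootExp_ne_one {N : ℕ} {x : ℤ} (h : ¬ (2 : ℤ) ^ N ∣ x) : rootExp N x ≠ 1 := by
  intro h1
  set y := x % 2 ^ N with hy
  have hM : (0 : ℤ) < 2 ^ N := by positivity
  have hy0 : 0 < y := lt_of_le_of_ne (Int.emod_nonneg _ hM.ne')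
    fun h' => h (Int.dvd_of_emod_eq_zero h'.symm)
  have hy1 : y < 2 ^ N := Int.emod_lt_of_pos _ hM
  have hxy : rootExp N x = rootExp N y := rootExp_congr (by
    rw [hy]; exact Int.dvd_self_sub_emod)
  have := le_norm_one_sub_rootExp hy0.le hy1.le
  rw [← hxy, h1, sub_self, norm_zero] at this
  have hy0' : (0 : ℝ) < y := by exact_mod_cast hy0
  have hy1' : (y : ℝ) < 2 ^ N := by exact_mod_cast hy1
  have hpos : 0 < 4 * min (y : ℝ) (2 ^ N - y) / 2 ^ N := by
    have : 0 < min (y : ℝ) (2 ^ N - y) := lt_min hy0' (by linarith)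
    positivity
  linarith

theorem sum_rootExp_mul (N : ℕ) (x : ℤ) :
    ∑ i ∈ Finset.range (2 ^ N), rootExp N (i * x) = if (2 : ℤ) ^ N ∣ x then 2 ^ N else 0 := by
  simp only [rootExp_natCast_mul]
  split_ifs with h
  · have : rootExp N x = 1 := by
      rw [rootExp_congr (y := 0) (by simpa using h), rootExp_zero]
    simp [this]
  · have h1 := geom_sum_mul_neg (rootExp N x) (2 ^ N)
    rw [rootExp_pow_two_pow, sub_self] at h1
    exact (mul_eq_zero.1 h1).resolve_right (sub_ne_zero.2 (rootExp_ne_one h).symm)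

theorem two_pow_dvd_sub_iff {N m n : ℕ} (hm : m < 2 ^ N) (hn : n < 2 ^ N) :
    (2 : ℤ) ^ N ∣ (m : ℤ) - n ↔ m = n := by
  refine ⟨fun h => ?_, fun h => by simp [h]⟩
  have h1 : (n : ℤ) ≡ m [ZMOD ((2 ^ N : ℕ) : ℤ)] := by
    rw [Int.modEq_iff_dvd]; exact_mod_cast h
  have h2 := Int.natCast_modEq_iff.1 h1
  rw [Nat.ModEq, Nat.mod_eq_of_lt hm, Nat.mod_eq_of_lt hn] at h2
  exact h2.symm

/-- Parseval's identity for the discrete Fourier transform. -/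
theorem sum_norm_sq_sum_rootExp (N : ℕ) (c : ℕ → ℂ) :
    ∑ i ∈ Finset.range (2 ^ N), ‖∑ n ∈ Finset.range (2 ^ N), c n * rootExp N (n * i)‖ ^ 2 =
      2 ^ N * ∑ n ∈ Finset.range (2 ^ N), ‖c n‖ ^ 2 := by
  apply Complex.ofReal_injective
  push_cast
  simp only [← Complex.mul_conj', map_sum, map_mul, conj_rootExp]
  calc ∑ i ∈ Finset.range (2 ^ N), (∑ n ∈ Finset.range (2 ^ N), c n * rootExp N (n * i)) *
        ∑ m ∈ Finset.range (2 ^ N), starRingEnd ℂ (c m) * rootExp N (-(m * i))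
      = ∑ i ∈ Finset.range (2 ^ N), ∑ n ∈ Finset.range (2 ^ N), ∑ m ∈ Finset.range (2 ^ N),
          c n * starRingEnd ℂ (c m) * rootExp N (i * (n - m)) := by
        refine Finset.sum_congr rfl fun i _ => ?_
        rw [Finset.sum_mul_sum]
        refine Finset.sum_congr rfl fun n _ => Finset.sum_congr rfl fun m _ => ?_
        rw [show (i : ℤ) * (n - m) = n * i + -(m * i) by ring, rootExp_add]
        ring
    _ = ∑ n ∈ Finset.range (2 ^ N), ∑ m ∈ Finset.range (2 ^ N),
          c n * starRingEnd ℂ (c m) * ∑ i ∈ Finset.range (2 ^ N), rootExp N (i * (n - m)) := by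
        rw [Finset.sum_comm]
        refine Finset.sum_congr rfl fun n _ => ?_
        rw [Finset.sum_comm]
        refine Finset.sum_congr rfl fun m _ => ?_
        rw [Finset.mul_sum]
    _ = ∑ n ∈ Finset.range (2 ^ N), c n * starRingEnd ℂ (c n) * 2 ^ N := by
        refine Finset.sum_congr rfl fun n hn => ?_
        rw [Finset.sum_eq_single n]
        · rw [sum_rootExp_mul, if_pos (by simp)]
        · intro m hm hmn
          rw [sum_rootExp_mul, if_neg, mul_zero]
          rw [two_pow_dvd_sub_iff (Finset.mem_range.1 hn) (Finset.mem_range.1 hm)]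
          exact hmn.symm
        · exact fun h => absurd hn h
    _ = _ := by rw [← Finset.sum_mul, mul_comm]

theorem sum_norm_sq_kernelSum_rieszKernel_le (N : ℕ) {r : ℝ} (h0 : 0 ≤ r) (h1 : r ≤ 1)
    (f : ℕ → ℂ) :
    ∑ i ∈ Finset.range (2 ^ N), ‖kernelSum N (rieszKernel N r) f i‖ ^ 2 ≤
      ∑ i ∈ Finset.range (2 ^ N), ‖f i‖ ^ 2 := by
  have hM : (0 : ℝ) < 2 ^ N := by positivity
  set c : ℕ → ℂ := fun n =>
    ((2 : ℂ) ^ N)⁻¹ * ∑ j ∈ Finset.range (2 ^ N), f j * rootExp N (-(n * j)) with hc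
  have hT : ∀ i, kernelSum N (rieszKernel N r) f i =
      ∑ n ∈ Finset.range (2 ^ N), ((r : ℂ) ^ n * c n) * rootExp N (n * i) := by
    intro i
    simp only [kernelSum, rieszKernel, hc, smul_eq_mul, Finset.mul_sum, Finset.sum_mul]
    rw [Finset.sum_comm]
    refine Finset.sum_congr rfl fun n _ => Finset.sum_congr rfl fun j _ => ?_
    rw [show (n : ℤ) * (i - j) = -(n * j) + n * i by ring, rootExp_add]
    ring
  have hsq : ∀ n, ‖c n‖ ^ 2 = ((2 : ℝ) ^ N)⁻¹ ^ 2 *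
      ‖∑ j ∈ Finset.range (2 ^ N), starRingEnd ℂ (f j) * rootExp N (j * n)‖ ^ 2 := by
    intro n
    have : ∑ j ∈ Finset.range (2 ^ N), starRingEnd ℂ (f j) * rootExp N (j * n) =
        starRingEnd ℂ (∑ j ∈ Finset.range (2 ^ N), f j * rootExp N (-(n * j))) := by
      rw [map_sum]
      refine Finset.sum_congr rfl fun j _ => ?_
      rw [map_mul, conj_rootExp, neg_neg, mul_comm (n : ℤ)]
    rw [this, RCLike.norm_conj, hc, norm_mul, mul_pow, norm_inv, norm_pow, Complex.norm_ofNat]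
  have hc2 : ∑ n ∈ Finset.range (2 ^ N), ‖c n‖ ^ 2 =
      ((2 : ℝ) ^ N)⁻¹ * ∑ j ∈ Finset.range (2 ^ N), ‖f j‖ ^ 2 := by
    simp only [hsq]
    rw [← Finset.mul_sum, sum_norm_sq_sum_rootExp]
    simp only [RCLike.norm_conj]
    field_simp
  simp only [hT]
  rw [sum_norm_sq_sum_rootExp]
  calc (2 : ℝ) ^ N * ∑ n ∈ Finset.range (2 ^ N), ‖(r : ℂ) ^ n * c n‖ ^ 2
      ≤ 2 ^ N * ∑ n ∈ Finset.range (2 ^ N), ‖c n‖ ^ 2 := by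
        gcongr with n _
        rw [norm_mul, norm_pow, Complex.norm_real, Real.norm_of_nonneg h0]
        exact mul_le_of_le_one_left (norm_nonneg _) (pow_le_one₀ h0 h1)
    _ = _ := by rw [hc2]; field_simp

/-- The characters are eigenvectors of the regularized discrete Riesz projection. -/
theorem kernelSum_rieszKernel_rootExp {E : Type*} [NormedAddCommGroup E] [NormedSpace ℂ E]
    {N : ℕ} (r : ℝ) {n : ℤ} {m : ℕ} (hm : m < 2 ^ N) (hmn : (2 : ℤ) ^ N ∣ m - n) (v : E) (i : ℕ) :
    kernelSum N (rieszKernel N r) (fun j => rootExp N (n * j) • v) i =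
      (r : ℂ) ^ m • rootExp N (n * i) • v := by
  have hM : (2 : ℂ) ^ N ≠ 0 := pow_ne_zero _ two_ne_zero
  have h : ∑ j ∈ Finset.range (2 ^ N), rieszKernel N r i j * rootExp N (n * j) =
      (r : ℂ) ^ m * rootExp N (n * i) := by
    calc ∑ j ∈ Finset.range (2 ^ N), rieszKernel N r i j * rootExp N (n * j)
        = ∑ l ∈ Finset.range (2 ^ N), ((2 : ℂ) ^ N)⁻¹ * (r : ℂ) ^ l * rootExp N (l * i) *
            ∑ j ∈ Finset.range (2 ^ N), rootExp N (j * (n - l)) := by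
          simp only [rieszKernel, Finset.mul_sum, Finset.sum_mul]
          rw [Finset.sum_comm]
          refine Finset.sum_congr rfl fun l _ => Finset.sum_congr rfl fun j _ => ?_
          rw [show (l : ℤ) * (i - j) = l * i + -(l * j) by ring,
            show (j : ℤ) * (n - l) = n * j + -(l * j) by ring, rootExp_add, rootExp_add]
          ring
      _ = (r : ℂ) ^ m * rootExp N (m * i) := by
          rw [Finset.sum_eq_single m]
          · rw [sum_rootExp_mul, if_pos (by rw [← neg_sub]; exact hmn.neg_right)]
            field_simp
          · intro l hl hlm
            rw [sum_rootExp_mul, if_neg, mul_zero]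
            intro h
            refine hlm ?_
            have h2 : (2 : ℤ) ^ N ∣ (m : ℤ) - l := by
              have := dvd_add hmn h
              rwa [sub_add_sub_cancel] at this
            exact ((two_pow_dvd_sub_iff hm (Finset.mem_range.1 hl)).1 h2).symm
          · exact fun h' => absurd (Finset.mem_range.2 hm) h'
      _ = _ := by
          rw [rootExp_congr (x := m * i) (y := n * i)]
          rw [← sub_mul]
          exact hmn.mul_right _
  rw [kernelSum, ← mul_smul, ← h, Finset.sum_smul]
  simp only [mul_smul]

/-- The `p`-th power of the norm of `ℓ_p(ℓ_q)`, over the indices `i < 2 ^ N`. -/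
def mixedSum (N : ℕ) (p q : ℝ) {n : ℕ} (f : Fin n → ℕ → ℂ) : ℝ :=
  ∑ i ∈ Finset.range (2 ^ N), (∑ k, ‖f k i‖ ^ q) ^ (p / q)

/-- The regularized discrete Riesz projections are uniformly bounded on `ℓ_p(ℓ_q)`. -/
def DiscreteRieszBounded (p q : ℝ) : Prop :=
  ∃ C : ℝ, 0 ≤ C ∧ ∀ (N : ℕ) (r : ℝ), 0 ≤ r → r ≤ 1 → ∀ (n : ℕ) (f : Fin n → ℕ → ℂ),
    mixedSum N p q (fun k => kernelSum N (rieszKernel N r) (f k)) ≤ C * mixedSum N p q f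

theorem mixedSum_nonneg (N : ℕ) (p q : ℝ) {n : ℕ} (f : Fin n → ℕ → ℂ) : 0 ≤ mixedSum N p q f :=
  Finset.sum_nonneg fun _ _ => rpow_nonneg (Finset.sum_nonneg fun _ _ => by positivity) _

theorem sum_sum_mul_le_mixedSum {p p' q q' : ℝ} (hp : p.HolderConjugate p')
    (hq : q.HolderConjugate q') (N : ℕ) {n : ℕ} (f g : Fin n → ℕ → ℂ) :
    ∑ i ∈ Finset.range (2 ^ N), ∑ k, ‖f k i‖ * ‖g k i‖ ≤
      mixedSum N p q f ^ (1 / p) * mixedSum N p' q' g ^ (1 / p') := by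
  have key : ∀ {p q : ℝ} (u : Fin n → ℕ → ℂ) (i : ℕ),
      |(∑ k, ‖u k i‖ ^ q) ^ (1 / q)| ^ p = (∑ k, ‖u k i‖ ^ q) ^ (p / q) := by
    intro p q u i
    have : 0 ≤ ∑ k, ‖u k i‖ ^ q := Finset.sum_nonneg fun _ _ => by positivity
    rw [abs_of_nonneg (by positivity), ← rpow_mul this]
    congr 1; ring
  calc _ ≤ ∑ i ∈ Finset.range (2 ^ N), (∑ k, ‖f k i‖ ^ q) ^ (1 / q) *
        (∑ k, ‖g k i‖ ^ q') ^ (1 / q') := by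
        refine Finset.sum_le_sum fun i _ => ?_
        have := Real.inner_le_Lp_mul_Lq Finset.univ (fun k => ‖f k i‖) (fun k => ‖g k i‖) hq
        simpa only [abs_norm] using this
    _ ≤ _ := by
        have := Real.inner_le_Lp_mul_Lq (Finset.range (2 ^ N))
          (fun i => (∑ k, ‖f k i‖ ^ q) ^ (1 / q)) (fun i => (∑ k, ‖g k i‖ ^ q') ^ (1 / q')) hp
        simpa only [key, mixedSum] using this

theorem exists_sum_mul_eq_rpow {ι : Type*} (s : Finset ι) {q q' : ℝ} (hq : q.HolderConjugate q')
    (v : ι → ℝ) (hv : ∀ k, 0 ≤ v k) :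
    ∃ w : ι → ℝ, (∀ k, 0 ≤ w k) ∧ ∑ k ∈ s, v k * w k = (∑ k ∈ s, v k ^ q) ^ (1 / q) ∧
      ∑ k ∈ s, w k ^ q' ≤ 1 := by
  lift v to ι → ℝ≥0 using hv
  obtain ⟨w, hw, h⟩ := (NNReal.isGreatest_Lp s v hq).1
  refine ⟨fun k => w k, fun k => (w k).2, ?_, ?_⟩
  · simp only at h ⊢
    exact_mod_cast h
  · simp only [Set.mem_ofPred_eq] at hw ⊢
    exact_mod_cast hw

theorem exists_mixedSum_eq {p p' q q' : ℝ} (hp : p.HolderConjugate p')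
    (hq : q.HolderConjugate q') (N : ℕ) {n : ℕ} (g : Fin n → ℕ → ℂ) :
    ∃ h : Fin n → ℕ → ℂ, mixedSum N p' q' h ≤ 1 ∧
      ∑ i ∈ Finset.range (2 ^ N), ∑ k, g k i * h k i = (mixedSum N p q g ^ (1 / p) : ℝ) := by
  choose w hw0 hw1 hw2 using fun i => exists_sum_mul_eq_rpow Finset.univ hq (fun k => ‖g k i‖)
    (fun k => norm_nonneg _)
  have hnn : ∀ i, 0 ≤ ∑ k, ‖g k i‖ ^ q := fun i => Finset.sum_nonneg fun _ _ => by positivity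
  obtain ⟨a, ha0, ha1, ha2⟩ := exists_sum_mul_eq_rpow (Finset.range (2 ^ N)) hp
    (fun i => (∑ k, ‖g k i‖ ^ q) ^ (1 / q)) (fun i => rpow_nonneg (hnn i) _)
  have hs : ∀ z : ℂ, ∃ u : ℂ, ‖u‖ ≤ 1 ∧ z * u = ‖z‖ := by
    intro z
    rcases eq_or_ne z 0 with rfl | hz
    · exact ⟨0, by simp⟩
    · have : (‖z‖ : ℂ) ≠ 0 := by simpa using hz
      refine ⟨‖z‖ / z, by simp [hz], by field_simp⟩
  choose u hu1 hu2 using hs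
  refine ⟨fun k i => u (g k i) * (a i * w i k : ℝ), ?_, ?_⟩
  · refine le_trans (Finset.sum_le_sum fun i _ => ?_) ha2
    calc (∑ k, ‖u (g k i) * (a i * w i k : ℝ)‖ ^ q') ^ (p' / q')
        ≤ (∑ k, a i ^ q' * w i k ^ q') ^ (p' / q') := by
          refine rpow_le_rpow (Finset.sum_nonneg fun _ _ => by positivity)
            (Finset.sum_le_sum fun k _ => ?_) (div_pos hp.symm.pos hq.symm.pos).le
          rw [← mul_rpow (ha0 i) (hw0 i k), norm_mul, Complex.norm_real,
            Real.norm_of_nonneg (mul_nonneg (ha0 i) (hw0 i k))]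
          exact rpow_le_rpow (mul_nonneg (norm_nonneg _) (mul_nonneg (ha0 i) (hw0 i k)))
            (mul_le_of_le_one_left (mul_nonneg (ha0 i) (hw0 i k)) (hu1 _)) hq.symm.pos.le
      _ ≤ (a i ^ q' * 1) ^ (p' / q') := by
          rw [← Finset.mul_sum]
          refine rpow_le_rpow (mul_nonneg (rpow_nonneg (ha0 i) _)
            (Finset.sum_nonneg fun k _ => rpow_nonneg (hw0 i k) _))
            (mul_le_mul_of_nonneg_left (hw2 i) (rpow_nonneg (ha0 i) _))
            (div_pos hp.symm.pos hq.symm.pos).le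
      _ = a i ^ p' := by
          rw [mul_one, ← rpow_mul (ha0 i), mul_div_cancel₀ _ hq.symm.ne_zero]
  · have h1 : mixedSum N p q g = ∑ i ∈ Finset.range (2 ^ N),
        ((∑ k, ‖g k i‖ ^ q) ^ (1 / q)) ^ p := by
      refine Finset.sum_congr rfl fun i _ => ?_
      rw [← rpow_mul (hnn i)]
      congr 1; ring
    rw [h1, ← ha1, Complex.ofReal_sum]
    refine Finset.sum_congr rfl fun i _ => ?_
    rw [← hw1, mul_comm, Complex.ofReal_mul, Complex.ofReal_sum, Finset.mul_sum]
    refine Finset.sum_congr rfl fun k _ => ?_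
    rw [← mul_assoc, hu2]
    push_cast
    ring

theorem sum_kernelSum_mul (N : ℕ) (r : ℝ) (f h : ℕ → ℂ) :
    ∑ i ∈ Finset.range (2 ^ N), kernelSum N (rieszKernel N r) f i * h i =
      ∑ i ∈ Finset.range (2 ^ N), f i *
        starRingEnd ℂ (kernelSum N (rieszKernel N r) (fun j => starRingEnd ℂ (h j)) i) := by
  simp only [kernelSum, smul_eq_mul, map_sum, map_mul, conj_rieszKernel, RCLike.conj_conj,
    Finset.sum_mul, Finset.mul_sum]
  rw [Finset.sum_comm]
  refine Finset.sum_congr rfl fun i _ => Finset.sum_congr rfl fun j _ => ?_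
  ring

theorem DiscreteRieszBounded.dual {p p' q q' : ℝ} (hp : p.HolderConjugate p')
    (hq : q.HolderConjugate q') (H : DiscreteRieszBounded p' q') : DiscreteRieszBounded p q := by
  obtain ⟨C, hC, H⟩ := H
  refine ⟨(C ^ (1 / p')) ^ p, by positivity, fun N r h0 h1 n f => ?_⟩
  set T := kernelSum (E := ℂ) N (rieszKernel N r) with hT
  obtain ⟨h, hh1, hh2⟩ := exists_mixedSum_eq hp hq N (fun k => T (f k))
  set h' : Fin n → ℕ → ℂ := fun k i => starRingEnd ℂ (h k i) with hh'
  have hle : mixedSum N p q (fun k => T (f k)) ^ (1 / p) ≤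
      mixedSum N p q f ^ (1 / p) * C ^ (1 / p') := by
    calc mixedSum N p q (fun k => T (f k)) ^ (1 / p)
        = ‖((mixedSum N p q (fun k => T (f k)) ^ (1 / p) : ℝ) : ℂ)‖ := by
          rw [Complex.norm_real, Real.norm_of_nonneg (rpow_nonneg (mixedSum_nonneg _ _ _ _) _)]
      _ = ‖∑ i ∈ Finset.range (2 ^ N), ∑ k, f k i * starRingEnd ℂ (T (h' k) i)‖ := by
          rw [← hh2, Finset.sum_comm]
          simp only [hT, sum_kernelSum_mul]
          rw [Finset.sum_comm]
      _ ≤ ∑ i ∈ Finset.range (2 ^ N), ∑ k, ‖f k i‖ * ‖T (h' k) i‖ := by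
          refine (norm_sum_le _ _).trans (Finset.sum_le_sum fun i _ => ?_)
          refine (norm_sum_le _ _).trans (Finset.sum_le_sum fun k _ => ?_)
          rw [norm_mul, RCLike.norm_conj]
      _ ≤ mixedSum N p q f ^ (1 / p) * mixedSum N p' q' (fun k => T (h' k)) ^ (1 / p') :=
          sum_sum_mul_le_mixedSum hp hq N f (fun k => T (h' k))
      _ ≤ _ := by
          refine mul_le_mul_of_nonneg_left ?_ (rpow_nonneg (mixedSum_nonneg _ _ _ _) _)
          refine rpow_le_rpow (mixedSum_nonneg _ _ _ _) ((H N r h0 h1 n h').trans ?_)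
            hp.symm.one_div_nonneg
          have : mixedSum N p' q' h' = mixedSum N p' q' h := by
            simp only [mixedSum, hh', RCLike.norm_conj]
          rw [this]
          exact mul_le_of_le_one_right hC hh1
  have := rpow_le_rpow (rpow_nonneg (mixedSum_nonneg _ _ _ _) _) hle hp.nonneg
  rw [← rpow_mul (mixedSum_nonneg _ _ _ _), mul_rpow (rpow_nonneg (mixedSum_nonneg _ _ _ _) _)
    (by positivity), ← rpow_mul (mixedSum_nonneg _ _ _ _), one_div_mul_cancel hp.ne_zero,
    Real.rpow_one, Real.rpow_one, mul_comm] at this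
  exact this

theorem mixedSum_self (N : ℕ) {p : ℝ} (hp : p ≠ 0) {n : ℕ} (f : Fin n → ℕ → ℂ) :
    mixedSum N p p f = ∑ k, ∑ i ∈ Finset.range (2 ^ N), ‖f k i‖ ^ p := by
  simp only [mixedSum, div_self hp, Real.rpow_one]
  rw [Finset.sum_comm]

theorem discreteRieszBounded_of_scalar {p C : ℝ} (hp : p ≠ 0) (hC : 0 ≤ C)
    (H : ∀ (N : ℕ) (r : ℝ), 0 ≤ r → r ≤ 1 → ∀ f : ℕ → ℂ,
      ∑ i ∈ Finset.range (2 ^ N), ‖kernelSum N (rieszKernel N r) f i‖ ^ p ≤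
        C * ∑ i ∈ Finset.range (2 ^ N), ‖f i‖ ^ p) : DiscreteRieszBounded p p := by
  refine ⟨C, hC, fun N r h0 h1 n f => ?_⟩
  rw [mixedSum_self N hp, mixedSum_self N hp, Finset.mul_sum]
  exact Finset.sum_le_sum fun k _ => H N r h0 h1 (f k)

theorem discreteRieszBounded_self {p : ℝ} (hp : 1 < p) : DiscreteRieszBounded p p := by
  have h2 : ∀ p : ℝ, 1 < p → p < 2 → DiscreteRieszBounded p p := by
    intro p hp hp2
    obtain ⟨C, hC, H⟩ := exists_sum_norm_kernelSum_rpow_le hp hp2 (by positivity : 0 ≤ 2 * π)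
      zero_le_one
    refine discreteRieszBounded_of_scalar (by linarith) hC fun N r h0 h1 f =>
      H ℂ N _ (hormanderBound_rieszKernel N h0 h1) (fun f => ?_) f
    simpa using sum_norm_sq_kernelSum_rieszKernel_le N h0 h1 f
  rcases lt_trichotomy p 2 with h | rfl | h
  · exact h2 p hp h
  · refine discreteRieszBounded_of_scalar two_ne_zero zero_le_one fun N r h0 h1 f => ?_
    simpa using sum_norm_sq_kernelSum_rieszKernel_le N h0 h1 f
  · have hc := Real.HolderConjugate.conjExponent hp
    refine (h2 _ hc.symm.lt ?_).dual hc hc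
    rw [Real.conjExponent, div_lt_iff₀ (by linarith)]
    linarith

theorem norm_toLp_rpow {q : ℝ} (hq : 1 < q) {n : ℕ} (v : Fin n → ℂ) (p : ℝ) :
    ‖(WithLp.toLp (ENNReal.ofReal q) v : PiLp (ENNReal.ofReal q) fun _ : Fin n => ℂ)‖ ^ p =
      (∑ k, ‖v k‖ ^ q) ^ (p / q) := by
  have hq' : (ENNReal.ofReal q).toReal = q := ENNReal.toReal_ofReal (by linarith)
  rw [PiLp.norm_eq_sum (by rw [hq']; linarith), hq',
    ← rpow_mul (Finset.sum_nonneg fun _ _ => by positivity)]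
  congr 1
  ring

theorem kernelSum_toLp (q : ℝ≥0∞) (N : ℕ) (k : ℕ → ℕ → ℂ) {n : ℕ} (f : Fin n → ℕ → ℂ) (i : ℕ) :
    kernelSum N k (fun j => (WithLp.toLp q (fun l => f l j) : PiLp q fun _ : Fin n => ℂ)) i =
      WithLp.toLp q (fun l => kernelSum N k (f l) i) := by
  ext l
  simp [kernelSum]

/-- The regularized discrete Riesz projections are uniformly bounded on `ℓ_p(ℓ_q)`. -/
theorem discreteRieszBounded {p q : ℝ} (hp : 1 < p) (hq : 1 < q) : DiscreteRieszBounded p q := by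
  have main : ∀ p q : ℝ, 1 < p → p < q → DiscreteRieszBounded p q := by
    intro p q hp hpq
    have hq : 1 < q := hp.trans hpq
    obtain ⟨B, hB, HB⟩ := discreteRieszBounded_self hq
    obtain ⟨C, hC, H⟩ := exists_sum_norm_kernelSum_rpow_le hp hpq (by positivity : 0 ≤ 2 * π) hB
    refine ⟨C, hC, fun N r h0 h1 n f => ?_⟩
    have : Fact (1 ≤ ENNReal.ofReal q) := ⟨by simpa using hq.le⟩
    have hsum : ∀ (s : ℝ) (f : Fin n → ℕ → ℂ), mixedSum N s q f = ∑ i ∈ Finset.range (2 ^ N),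
        ‖(WithLp.toLp (ENNReal.ofReal q) (fun l => f l i) :
          PiLp (ENNReal.ofReal q) fun _ : Fin n => ℂ)‖ ^ s := by
      intro s f
      simp only [norm_toLp_rpow hq, mixedSum]
    rw [hsum, hsum]
    simp only [← kernelSum_toLp]
    refine H (PiLp (ENNReal.ofReal q) fun _ : Fin n => ℂ) N _ (hormanderBound_rieszKernel N h0 h1)
      (fun f => ?_) _
    have := HB N r h0 h1 n (fun l i => f i l)
    rw [hsum, hsum] at this
    simpa only [← kernelSum_toLp] using this
  rcases lt_trichotomy p q with h | rfl | h
  · exact main p q hp h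
  · exact discreteRieszBounded_self hp
  · have hcp := Real.HolderConjugate.conjExponent hp
    have hcq := Real.HolderConjugate.conjExponent hq
    refine (main _ _ hcp.symm.lt ?_).dual hcp hcq
    rw [Real.conjExponent, Real.conjExponent, div_lt_div_iff₀ (by linarith) (by linarith)]
    nlinarith

theorem fourier_add_two_pow (n : ℤ) (x : 𝕋) (N j : ℕ) :
    fourier n (x + ((2 * π * j / 2 ^ N : ℝ) : 𝕋)) = rootExp N (n * j) * fourier n x := by
  have h : fourier n (((2 * π * j / 2 ^ N : ℝ)) : 𝕋) = rootExp N (n * j) := by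
    rw [fourier_coe_apply, rootExp]
    congr 1
    push_cast
    field_simp
  rw [← h, fourier_apply, fourier_apply, fourier_apply, smul_add, AddCircle.toCircle_add,
    mul_comm, Circle.coe_mul]

/-- The `p`-th power of the pointwise `ℓ_q`-norm of a vector of trigonometric polynomials with
Fourier coefficients `w n * c k n`. -/
def trigNormPow (p q : ℝ) {d : ℕ} (c : Fin d → ℤ → ℂ) (S : Finset ℤ) (w : S → ℝ) (x : 𝕋) : ℝ :=
  (∑ k, ‖∑ n : S, (w n : ℂ) * (c k n * fourier (n : ℤ) x)‖ ^ q) ^ (p / q)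

theorem continuous_trigNormPow {p q : ℝ} (hp : 0 < p) (hq : 0 < q) {d : ℕ} (c : Fin d → ℤ → ℂ)
    (S : Finset ℤ) : Continuous (Function.uncurry (trigNormPow p q c S)) := by
  unfold trigNormPow Function.uncurry
  refine Continuous.rpow_const (continuous_finsetSum _ fun k _ => ?_)
    fun _ => Or.inr (div_pos hp hq).le
  refine Continuous.rpow_const ?_ fun _ => Or.inr hq.le
  fun_prop

theorem kernelSum_finset_sum {ι E : Type*} [NormedAddCommGroup E] [NormedSpace ℂ E] (N : ℕ)
    (k : ℕ → ℕ → ℂ) (s : Finset ι) (f : ι → ℕ → E) (i : ℕ) :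
    kernelSum N k (fun j => ∑ a ∈ s, f a j) i = ∑ a ∈ s, kernelSum N k (f a) i := by
  simp only [kernelSum, Finset.smul_sum]
  exact Finset.sum_comm

/-- The exponents `m n` of the eigenvalues of the regularized discrete Riesz projection. -/
def freqMod (N : ℕ) (n : ℤ) : ℕ := if 0 ≤ n then n.toNat else (2 ^ N + n).toNat

theorem sum_trigNormPow_le {p q C : ℝ}
    (H : ∀ (N : ℕ) (r : ℝ), 0 ≤ r → r ≤ 1 → ∀ (n : ℕ) (f : Fin n → ℕ → ℂ),
      mixedSum N p q (fun k => kernelSum N (rieszKernel N r) (f k)) ≤ C * mixedSum N p q f)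
    {d : ℕ} (c : Fin d → ℤ → ℂ) (S : Finset ℤ) {N : ℕ} (hS : ∀ n ∈ S, |n| < 2 ^ N) {r : ℝ}
    (h0 : 0 ≤ r) (h1 : r ≤ 1) (x : 𝕋) :
    ∑ i ∈ Finset.range (2 ^ N),
        trigNormPow p q c S (fun n => r ^ freqMod N n) (x + ((2 * π * i / 2 ^ N : ℝ) : 𝕋)) ≤
      C * ∑ i ∈ Finset.range (2 ^ N),
        trigNormPow p q c S (fun _ => 1) (x + ((2 * π * i / 2 ^ N : ℝ) : 𝕋)) := by
  have hm : ∀ n : S, freqMod N n < 2 ^ N ∧ (2 : ℤ) ^ N ∣ freqMod N n - n := by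
    intro n
    have := abs_lt.1 (hS n n.2)
    have hcast : ((2 ^ N : ℕ) : ℤ) = 2 ^ N := by push_cast; rfl
    unfold freqMod
    split_ifs with h
    · refine ⟨?_, by simp [Int.toNat_of_nonneg h]⟩
      zify
      rw [Int.toNat_of_nonneg h]
      exact this.2
    · have h' : (0 : ℤ) ≤ 2 ^ N + n := by linarith
      refine ⟨?_, by simp [Int.toNat_of_nonneg h']⟩
      zify
      rw [Int.toNat_of_nonneg h']
      linarith
  have := H N r h0 h1 d
    fun k j => ∑ n : S, c k n * fourier (n : ℤ) (x + ((2 * π * j / 2 ^ N : ℝ) : 𝕋))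
  refine le_of_eq_of_le ?_ (this.trans_eq ?_)
  · refine Finset.sum_congr rfl fun i _ => ?_
    rw [trigNormPow]
    congr 2
    ext k
    congr 2
    beta_reduce
    rw [kernelSum_finset_sum]
    refine Finset.sum_congr rfl fun n _ => ?_
    have h3 := kernelSum_rieszKernel_rootExp r (hm n).1 (hm n).2 (c k n * fourier (n : ℤ) x) i
    simp only [smul_eq_mul] at h3
    simp only [fourier_add_two_pow, mul_left_comm (c k n)]
    rw [h3]
    push_cast
    ring
  · simp [trigNormPow, mixedSum]

theorem continuous_integral_trigNormPow {p q : ℝ} (hp : 0 < p) (hq : 0 < q) {d : ℕ}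
    (c : Fin d → ℤ → ℂ) (S : Finset ℤ) :
    Continuous fun w : S → ℝ => ∫ x, trigNormPow p q c S w x ∂μ𝕋 := by
  have := continuous_parametric_integral_of_continuous (μ := μ𝕋)
    (continuous_trigNormPow hp hq c S) isCompact_univ
  simpa using this

theorem integrable_trigNormPow {p q : ℝ} (hp : 0 < p) (hq : 0 < q) {d : ℕ}
    (c : Fin d → ℤ → ℂ) (S : Finset ℤ) (w : S → ℝ) :
    Integrable (trigNormPow p q c S w) μ𝕋 := by
  have h : Continuous (trigNormPow p q c S w) := (continuous_trigNormPow hp hq c S).uncurry_left w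
  exact h.integrable_of_hasCompactSupport (HasCompactSupport.of_compactSpace _)

theorem integral_trigNormPow_pow_freqMod_le {p q C : ℝ} (hp : 0 < p) (hq : 0 < q)
    (H : ∀ (N : ℕ) (r : ℝ), 0 ≤ r → r ≤ 1 → ∀ (n : ℕ) (f : Fin n → ℕ → ℂ),
      mixedSum N p q (fun k => kernelSum N (rieszKernel N r) (f k)) ≤ C * mixedSum N p q f)
    {d : ℕ} (c : Fin d → ℤ → ℂ) (S : Finset ℤ) {N : ℕ} (hS : ∀ n ∈ S, |n| < 2 ^ N) {r : ℝ}
    (h0 : 0 ≤ r) (h1 : r ≤ 1) :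
    ∫ x, trigNormPow p q c S (fun n => r ^ freqMod N n) x ∂μ𝕋 ≤
      C * ∫ x, trigNormPow p q c S (fun _ => 1) x ∂μ𝕋 := by
  have hint : ∀ (w : S → ℝ), ∀ i ∈ Finset.range (2 ^ N), Integrable (fun x =>
      trigNormPow p q c S w (x + ((2 * π * i / 2 ^ N : ℝ) : 𝕋))) μ𝕋 :=
    fun w i _ => (integrable_trigNormPow hp hq c S w).comp_add_right _
  have hsum : ∀ w : S → ℝ, ∫ x, ∑ i ∈ Finset.range (2 ^ N),
      trigNormPow p q c S w (x + ((2 * π * i / 2 ^ N : ℝ) : 𝕋)) ∂μ𝕋 =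
        2 ^ N * ∫ x, trigNormPow p q c S w x ∂μ𝕋 := by
    intro w
    rw [integral_finsetSum _ (hint w), Finset.sum_congr rfl fun i _ =>
      integral_add_right_eq_self (trigNormPow p q c S w) _]
    simp
  have h2 := integral_mono (μ := μ𝕋) (integrable_finsetSum _ (hint _))
    ((integrable_finsetSum _ (hint _)).const_mul C)
    (fun x => sum_trigNormPow_le H c S hS h0 h1 x)
  rw [integral_const_mul, hsum, hsum, mul_left_comm] at h2
  exact le_of_mul_le_mul_left h2 (by positivity)

theorem tendsto_pow_freqMod {r : ℝ} (h0 : 0 ≤ r) (h1 : r < 1) (n : ℤ) :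
    Filter.Tendsto (fun N : ℕ => r ^ freqMod N n) Filter.atTop
      (nhds (if 0 ≤ n then r ^ n.toNat else 0)) := by
  by_cases hn : 0 ≤ n
  · simp [freqMod, hn]
  · simp only [freqMod, hn, if_false]
    refine (tendsto_pow_atTop_nhds_zero_of_lt_one h0 h1).comp ?_
    refine Filter.tendsto_atTop.2 fun b => ?_
    filter_upwards [(tendsto_pow_atTop_atTop_of_one_lt
      (one_lt_two : (1 : ℤ) < 2)).eventually_gt_atTop (b - n : ℤ)] with N hN
    lia

/-- Boundedness of the Riesz projection on vectors of trigonometric polynomials. -/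
theorem exists_integral_trigNormPow_le {p q : ℝ} (hp : 1 < p) (hq : 1 < q) :
    ∃ C : ℝ, 0 ≤ C ∧ ∀ (d : ℕ) (c : Fin d → ℤ → ℂ) (S : Finset ℤ),
      ∫ x, trigNormPow p q c S (fun n => if 0 ≤ (n : ℤ) then 1 else 0) x ∂μ𝕋 ≤
        C * ∫ x, trigNormPow p q c S (fun _ => 1) x ∂μ𝕋 := by
  obtain ⟨C, hC, H⟩ := discreteRieszBounded hp hq
  have hp0 : 0 < p := by linarith
  have hq0 : 0 < q := by linarith
  refine ⟨C, hC, fun d c S => ?_⟩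
  have hcont := continuous_integral_trigNormPow hp0 hq0 c S
  set D : (S → ℝ) → ℝ := fun w => ∫ x, trigNormPow p q c S w x ∂μ𝕋 with hD
  change D (fun n => if 0 ≤ (n : ℤ) then 1 else 0) ≤ C * D fun _ => 1
  have hS : ∀ᶠ N : ℕ in Filter.atTop, ∀ n ∈ S, |n| < 2 ^ N := by
    rw [Filter.eventually_all_finset]
    intro n _
    exact (tendsto_pow_atTop_atTop_of_one_lt (one_lt_two : (1 : ℤ) < 2)).eventually_gt_atTop _
  have step : ∀ r : ℝ, 0 ≤ r → r < 1 →
      D (fun n => if 0 ≤ (n : ℤ) then r ^ (n : ℤ).toNat else 0) ≤ C * D fun _ => 1 := by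
    intro r h0 h1
    have hw : Filter.Tendsto (fun (N : ℕ) (n : S) => r ^ freqMod N n) Filter.atTop
        (nhds fun n => if 0 ≤ (n : ℤ) then r ^ (n : ℤ).toNat else 0) :=
      tendsto_pi_nhds.2 fun n => tendsto_pow_freqMod h0 h1 n
    refine le_of_tendsto ((hcont.tendsto _).comp hw) ?_
    filter_upwards [hS] with N hN
    exact integral_trigNormPow_pow_freqMod_le hp0 hq0 H c S hN h0 h1.le
  have hlim : Filter.Tendsto (fun m : ℕ => (1 - 1 / ((m : ℝ) + 1))) Filter.atTop (nhds 1) := by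
    simpa using tendsto_one_div_add_atTop_nhds_zero_nat.const_sub (1 : ℝ)
  have hw : Filter.Tendsto (fun (m : ℕ) (n : S) =>
      if 0 ≤ (n : ℤ) then (1 - 1 / ((m : ℝ) + 1)) ^ (n : ℤ).toNat else 0) Filter.atTop
        (nhds fun n => if 0 ≤ (n : ℤ) then 1 else 0) := by
    refine tendsto_pi_nhds.2 fun n => ?_
    by_cases hn : 0 ≤ (n : ℤ)
    · simpa [hn] using hlim.pow (n : ℤ).toNat
    · simp [hn]
  refine le_of_tendsto ((hcont.tendsto _).comp hw) (Filter.Eventually.of_forall fun m => ?_)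
  refine step _ ?_ ?_
  · have : 1 / ((m : ℝ) + 1) ≤ 1 := by
      rw [div_le_one (by positivity)]; linarith [m.cast_nonneg (α := ℝ)]
    linarith
  · have : 0 < 1 / ((m : ℝ) + 1) := by positivity
    linarith

theorem one_le_ofReal_fact {p : ℝ} (hp : 1 < p) : Fact (1 ≤ ENNReal.ofReal p) :=
  ⟨by simpa using hp.le⟩

theorem ofReal_trigNormPow {p q : ℝ} (hp : 0 < p) (hq : 0 < q) {d : ℕ} (c : Fin d → ℤ → ℂ)
    (S : Finset ℤ) (w : S → ℝ) (x : 𝕋) :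
    ENNReal.ofReal (trigNormPow p q c S w x) =
      (∑ k, ‖∑ n : S, (w n : ℂ) * (c k n * fourier (n : ℤ) x)‖ₑ ^ q) ^ (p / q) := by
  rw [trigNormPow, ← ENNReal.ofReal_rpow_of_nonneg
    (Finset.sum_nonneg fun _ _ => by positivity) (div_pos hp hq).le,
    ENNReal.ofReal_sum_of_nonneg fun _ _ => by positivity]
  congr 1
  refine Finset.sum_congr rfl fun k _ => ?_
  rw [← ENNReal.ofReal_rpow_of_nonneg (norm_nonneg _) hq.le, ofReal_norm]

section

variable (p q : ℝ≥0∞) [Fact (1 ≤ p)] [Fact (1 ≤ q)]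

/-- The trigonometric polynomial with Fourier coefficients `w n * c n`, as an element of `L^p`. -/
def trigLp (w : ℤ → ℝ) : (ℤ →₀ ℂ) →ₗ[ℂ] Lp ℂ p μ𝕋 :=
  Finsupp.linearCombination ℂ fun n => (w n : ℂ) • fourierLp p n

variable {p q} in
theorem coeFn_trigLp (w : ℤ → ℝ) (c : ℤ →₀ ℂ) {S : Finset ℤ} (hS : c.support ⊆ S) :
    trigLp p w c =ᵐ[μ𝕋] fun x => ∑ n : S, (w n : ℂ) * (c n * fourier (n : ℤ) x) := by
  have h1 : trigLp p w c = ∑ n ∈ S, (c n * w n) • fourierLp p n := by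
    rw [trigLp, Finsupp.linearCombination_apply, Finsupp.sum_of_support_subset _ hS _ (by simp)]
    simp only [smul_smul]
  rw [h1]
  have h2 : ∀ᵐ x ∂μ𝕋, ∀ n : ℤ, fourierLp p n x = fourier n x ∧
      ((c n * w n) • fourierLp p n : Lp ℂ p μ𝕋) x = (c n * w n) • fourierLp p n x :=
    ae_all_iff.2 fun n => (coeFn_fourierLp p n).and (Lp.coeFn_smul _ _)
  filter_upwards [h2, Lp.coeFn_finsetSum S fun n => (c n * w n) • fourierLp p n] with x hx hx'
  rw [hx', Finset.sum_apply, ← Finset.sum_coe_sort]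
  refine Finset.sum_congr rfl fun n _ => ?_
  rw [(hx n).2, (hx n).1, smul_eq_mul]
  ring

variable {p} in
theorem denseRange_trigLp (hp : p ≠ ∞) : DenseRange (trigLp p fun _ => 1) := by
  have h := span_fourierLp_closure_eq_top (T := 2 * π) hp
  have hr : LinearMap.range (trigLp p fun _ => 1) =
      Submodule.span ℂ (Set.range (@fourierLp (2 * π) _ p _)) := by
    rw [trigLp, Finsupp.range_linearCombination]
    simp
  rw [← hr] at h
  exact (Submodule.dense_iff_topologicalClosure_eq_top.2 h)

/-- The natural map from `d`-tuples in `L^p` to `L^p(ℓ_q^d)`. -/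
def vecLp (d : ℕ) : (Fin d → Lp ℂ p μ𝕋) →L[ℂ] Lp (PiLp q fun _ : Fin d => ℂ) p μ𝕋 :=
  ∑ k, (((PiLp.continuousLinearEquiv q ℂ fun _ : Fin d => ℂ).symm.toContinuousLinearMap ∘L
    ContinuousLinearMap.single ℂ (fun _ => ℂ) k).compLpL p μ𝕋) ∘L ContinuousLinearMap.proj k

variable {p q} in
theorem coeFn_vecLp {d : ℕ} (u : Fin d → Lp ℂ p μ𝕋) :
    vecLp p q d u =ᵐ[μ𝕋] fun x => WithLp.toLp q fun k => u k x := by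
  have h : vecLp p q d u = ∑ k, ((PiLp.continuousLinearEquiv q ℂ
      fun _ : Fin d => ℂ).symm.toContinuousLinearMap ∘L
      ContinuousLinearMap.single ℂ (fun _ => ℂ) k).compLpL p μ𝕋 (u k) := by
    simp [vecLp]
  rw [h]
  filter_upwards [Lp.coeFn_finsetSum Finset.univ fun k => ((PiLp.continuousLinearEquiv q ℂ
      fun _ : Fin d => ℂ).symm.toContinuousLinearMap ∘L
      ContinuousLinearMap.single ℂ (fun _ => ℂ) k).compLpL p μ𝕋 (u k),
    ae_all_iff.2 fun k => ((PiLp.continuousLinearEquiv q ℂ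
      fun _ : Fin d => ℂ).symm.toContinuousLinearMap ∘L
      ContinuousLinearMap.single ℂ (fun _ => ℂ) k).coeFn_compLpL (u k)] with x hx hx'
  rw [hx, Finset.sum_apply]
  ext l
  simp [hx', Pi.single_apply]

end

theorem enorm_vecLp_rpow {p q : ℝ} (hp : 0 < p) (hq : 0 < q) [Fact (1 ≤ ENNReal.ofReal p)]
    [Fact (1 ≤ ENNReal.ofReal q)] {d : ℕ} (u : Fin d → Lp ℂ (ENNReal.ofReal p) μ𝕋) :
    ‖vecLp (ENNReal.ofReal p) (ENNReal.ofReal q) d u‖ₑ ^ p =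
      ∫⁻ x, (∑ k, ‖u k x‖ₑ ^ q) ^ (p / q) ∂μ𝕋 := by
  have hp' : (ENNReal.ofReal p).toReal = p := ENNReal.toReal_ofReal hp.le
  have hq' : (ENNReal.ofReal q).toReal = q := ENNReal.toReal_ofReal hq.le
  rw [Lp.enorm_def, eLpNorm_eq_lintegral_rpow_enorm_toReal (by simpa using hp)
    ENNReal.ofReal_ne_top, hp', ← ENNReal.rpow_mul, one_div_mul_cancel hp.ne', ENNReal.rpow_one]
  refine lintegral_congr_ae ?_
  filter_upwards [coeFn_vecLp (q := ENNReal.ofReal q) u] with x hx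
  rw [hx, ← ofReal_norm, PiLp.norm_eq_sum (by rwa [hq']), hq',
    ← ENNReal.ofReal_rpow_of_nonneg (Finset.sum_nonneg fun _ _ => by positivity)
      (by positivity), ENNReal.ofReal_sum_of_nonneg fun _ _ => by positivity, ← ENNReal.rpow_mul]
  congr 1
  · refine Finset.sum_congr rfl fun k _ => ?_
    rw [← ENNReal.ofReal_rpow_of_nonneg (norm_nonneg _) hq.le, ofReal_norm]
  · ring

theorem enorm_vecLp_trigLp_rpow {p q : ℝ} (hp : 0 < p) (hq : 0 < q) [Fact (1 ≤ ENNReal.ofReal p)]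
    [Fact (1 ≤ ENNReal.ofReal q)] {d : ℕ} (w : ℤ → ℝ) (c : Fin d → ℤ →₀ ℂ) {S : Finset ℤ}
    (hS : ∀ k, (c k).support ⊆ S) :
    ‖vecLp (ENNReal.ofReal p) (ENNReal.ofReal q) d fun k => trigLp _ w (c k)‖ₑ ^ p =
      ENNReal.ofReal (∫ x, trigNormPow p q (fun k => c k) S (fun n => w n) x ∂μ𝕋) := by
  rw [enorm_vecLp_rpow hp hq,
    ofReal_integral_eq_lintegral_ofReal (integrable_trigNormPow hp hq _ _ _)]
  · refine lintegral_congr_ae ?_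
    filter_upwards [ae_all_iff.2 fun k => coeFn_trigLp (p := ENNReal.ofReal p) w (c k) (hS k)]
      with x hx
    simp only [hx, ofReal_trigNormPow hp hq]
  · exact Filter.Eventually.of_forall fun x =>
      rpow_nonneg (Finset.sum_nonneg fun _ _ => by positivity) _

/-- Boundedness of the Riesz projection on trigonometric polynomials, in `L^p(ℓ_q)`. -/
theorem exists_norm_vecLp_trigLp_le {p q : ℝ} (hp : 1 < p) (hq : 1 < q)
    [Fact (1 ≤ ENNReal.ofReal p)] [Fact (1 ≤ ENNReal.ofReal q)] :
    ∃ C : ℝ≥0, ∀ (d : ℕ) (c : Fin d → ℤ →₀ ℂ),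
      ‖vecLp (ENNReal.ofReal p) (ENNReal.ofReal q) d
        fun k => trigLp _ (fun n => if 0 ≤ n then 1 else 0) (c k)‖ ≤
      C * ‖vecLp (ENNReal.ofReal p) (ENNReal.ofReal q) d fun k => trigLp _ (fun _ => 1) (c k)‖ := by
  obtain ⟨C, hC, H⟩ := exists_integral_trigNormPow_le hp hq
  have hp0 : 0 < p := by linarith
  have hq0 : 0 < q := by linarith
  refine ⟨C.toNNReal ^ (1 / p), fun d c => ?_⟩
  set S : Finset ℤ := Finset.univ.biUnion fun k => (c k).support with hS
  have hS' : ∀ k, (c k).support ⊆ S := fun k =>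
    Finset.subset_biUnion_of_mem (fun k => (c k).support) (Finset.mem_univ k)
  have h := ENNReal.ofReal_le_ofReal (H d (fun k => c k) S)
  rw [ENNReal.ofReal_mul hC] at h
  have h1 := enorm_vecLp_trigLp_rpow hp0 hq0 (fun n => if 0 ≤ n then 1 else 0) c hS'
  have h2 := enorm_vecLp_trigLp_rpow hp0 hq0 (fun _ => 1) c hS'
  rw [← h1, ← h2] at h
  have h3 := ENNReal.rpow_le_rpow h (one_div_pos.2 hp0).le
  rw [ENNReal.mul_rpow_of_nonneg _ _ (one_div_pos.2 hp0).le, ← ENNReal.rpow_mul,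
    ← ENNReal.rpow_mul, mul_one_div_cancel hp0.ne', ENNReal.rpow_one, ENNReal.rpow_one,
    show ENNReal.ofReal C = (C.toNNReal : ℝ≥0∞) from rfl,
    ← ENNReal.coe_rpow_of_nonneg _ (one_div_pos.2 hp0).le,
    enorm_eq_nnnorm, enorm_eq_nnnorm] at h3
  exact_mod_cast h3

section

variable {p p' : ℝ≥0∞} [Fact (1 ≤ p)] [Fact (1 ≤ p')]

theorem lpPairing_fourierLp [p.HolderConjugate p'] (f : Lp ℂ p μ𝕋) (n : ℤ) :
    (ContinuousLinearMap.mul ℂ ℂ).lpPairing μ𝕋 p p' f (fourierLp p' n) = fourierCoeff f (-n) := by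
  rw [ContinuousLinearMap.lpPairing_eq_integral, fourierCoeff, neg_neg]
  refine integral_congr_ae ?_
  filter_upwards [coeFn_fourierLp (T := 2 * π) p' n] with x hx
  rw [hx, ContinuousLinearMap.mul_apply', smul_eq_mul, mul_comm]

theorem continuous_fourierCoeff (n : ℤ) :
    Continuous fun f : Lp ℂ p μ𝕋 => fourierCoeff f n := by
  have hc : p.HolderConjugate (ENNReal.conjExponent p) := .conjExponent Fact.out
  have : Fact (1 ≤ ENNReal.conjExponent p) := ⟨ENNReal.HolderConjugate.one_le _ p⟩
  have h : (fun f : Lp ℂ p μ𝕋 => fourierCoeff f n) = fun f : Lp ℂ p μ𝕋 =>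
      (ContinuousLinearMap.mul ℂ ℂ).lpPairing μ𝕋 p (ENNReal.conjExponent p) f
        (fourierLp _ (-n)) := by
    funext f
    rw [lpPairing_fourierLp, neg_neg]
  rw [h]
  exact (((ContinuousLinearMap.mul ℂ ℂ).lpPairing μ𝕋 p (ENNReal.conjExponent p)).flip _).continuous

/-- A function in `L^p`, `1 < p`, whose Fourier coefficients all vanish is zero. -/
theorem Lp_eq_zero_of_fourierCoeff_eq_zero (hp : 1 < p) (f : Lp ℂ p μ𝕋)
    (hf : ∀ n, fourierCoeff f n = 0) : f = 0 := by
  have hc : p.HolderConjugate (ENNReal.conjExponent p) := .conjExponent Fact.out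
  set r := ENNReal.conjExponent p with hr
  have : Fact (1 ≤ r) := ⟨ENNReal.HolderConjugate.one_le r p⟩
  have hrtop : r ≠ ∞ := ((ENNReal.HolderConjugate.lt_top_iff_one_lt r p).2 hp).ne
  have h0 : (ContinuousLinearMap.mul ℂ ℂ).lpPairing μ𝕋 p r f = 0 := by
    refine ContinuousLinearMap.ext_on (s := Set.range (@fourierLp (2 * π) _ r _))
      (Submodule.dense_iff_topologicalClosure_eq_top.2 (span_fourierLp_closure_eq_top hrtop)) ?_
    rintro _ ⟨n, rfl⟩
    rw [lpPairing_fourierLp, hf]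
    rfl
  have hint : Integrable f μ𝕋 := (Lp.memLp f).integrable hp.le
  refine (Lp.eq_zero_iff_ae_eq_zero).2 (hint.ae_eq_zero_of_forall_setIntegral_eq_zero ?_)
  intro s hs _
  have h1 := congrArg (fun φ => φ (indicatorConstLp r hs (measure_ne_top μ𝕋 s) (1 : ℂ))) h0
  simp only [ContinuousLinearMap.lpPairing_eq_integral, zero_apply] at h1
  rw [← h1, ← integral_indicator hs]
  refine integral_congr_ae ?_
  filter_upwards [indicatorConstLp_coeFn (p := r) (hs := hs) (hμs := measure_ne_top μ𝕋 s)
    (c := (1 : ℂ))] with x hx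
  rw [hx]
  by_cases hxs : x ∈ s <;> simp [hxs]

theorem ae_eq_of_fourierCoeff_eq (hp : 1 < p) {f g : 𝕋 → ℂ} (hf : MemLp f p μ𝕋)
    (hg : MemLp g p μ𝕋) (h : ∀ n, fourierCoeff f n = fourierCoeff g n) : f =ᵐ[μ𝕋] g := by
  have h1 := hf.coeFn_toLp
  have h2 := hg.coeFn_toLp
  have h3 := Lp_eq_zero_of_fourierCoeff_eq_zero hp (hf.toLp f - hg.toLp g) fun n => by
    rw [fourierCoeff_congr_ae ((Lp.coeFn_sub _ _).trans (h1.sub h2)), sub_eq_add_neg,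
      fourierCoeff.add (hf.integrable hp.le) (hg.integrable hp.le).neg, Pi.add_apply, h]
    have : fourierCoeff (-g) n = - fourierCoeff g n := by
      simp only [fourierCoeff, Pi.neg_apply, smul_neg, integral_neg]
    rw [this, add_neg_cancel]
  rw [sub_eq_zero] at h3
  filter_upwards [h1, h2] with x hx hx'
  rw [← hx, ← hx', h3]

theorem fourierCoeff_trigLp (w : ℤ → ℝ) (c : ℤ →₀ ℂ) (n : ℤ) :
    fourierCoeff (trigLp p w c) n = w n * c n := by
  rw [fourierCoeff_congr_ae (coeFn_trigLp w c (Finset.subset_insert n c.support))]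
  have h1 : (fun x : 𝕋 => ∑ m : ↥(insert n c.support),
      (w m : ℂ) * (c m * fourier (m : ℤ) x)) = (∑ m ∈ insert n c.support,
        ((w m * c m : ℂ) • (fourier m : 𝕋 → ℂ)) : 𝕋 → ℂ) := by
    funext x
    rw [Finset.sum_apply, ← Finset.sum_coe_sort (insert n c.support)]
    refine Finset.sum_congr rfl fun m _ => ?_
    rw [Pi.smul_apply, smul_eq_mul, mul_assoc]
  have hint : ∀ m : ℤ, Integrable (fourier m : 𝕋 → ℂ) μ𝕋 := fun m =>
    (fourier m).continuous.integrable_of_hasCompactSupport (HasCompactSupport.of_compactSpace _)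
  rw [h1, fourierCoeff.sum _ _ fun m _ => (hint m).smul _, Finset.sum_apply,
    Finset.sum_eq_single_of_mem n (Finset.mem_insert_self _ _)]
  · rw [fourierCoeff.const_smul, fourierCoeff_fourier, Pi.single_eq_same, smul_eq_mul, mul_one]
  · intro m _ hm
    rw [fourierCoeff.const_smul, fourierCoeff_fourier, Pi.single_eq_of_ne hm.symm, smul_zero]

end

/-- The Riesz projection on `L^p`. -/
def rieszLp (p : ℝ≥0∞) [Fact (1 ≤ p)] : Lp ℂ p μ𝕋 →L[ℂ] Lp ℂ p μ𝕋 :=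
  (trigLp p fun n => if 0 ≤ n then 1 else 0).extendOfNorm (trigLp p fun _ => 1)

theorem norm_vecLp_one {p : ℝ} (hp : 0 < p) [Fact (1 ≤ ENNReal.ofReal p)]
    (u : Lp ℂ (ENNReal.ofReal p) μ𝕋) :
    ‖vecLp (ENNReal.ofReal p) (ENNReal.ofReal p) 1 fun _ => u‖ = ‖u‖ := by
  have h : ‖vecLp (ENNReal.ofReal p) (ENNReal.ofReal p) 1 fun _ => u‖ₑ ^ p = ‖u‖ₑ ^ p := by
    rw [enorm_vecLp_rpow hp hp, Lp.enorm_def, eLpNorm_eq_lintegral_rpow_enorm_toReal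
      (by simpa using hp) ENNReal.ofReal_ne_top, ENNReal.toReal_ofReal hp.le, ← ENNReal.rpow_mul,
      one_div_mul_cancel hp.ne', ENNReal.rpow_one]
    simp [div_self hp.ne']
  have h' := ENNReal.rpow_left_injective hp.ne' h
  rw [← toReal_enorm, h', toReal_enorm]

theorem rieszLp_trigLp {p : ℝ} (hp : 1 < p) [Fact (1 ≤ ENNReal.ofReal p)] (c : ℤ →₀ ℂ) :
    rieszLp (ENNReal.ofReal p) (trigLp _ (fun _ => 1) c) =
      trigLp _ (fun n => if 0 ≤ n then 1 else 0) c := by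
  obtain ⟨C, hC⟩ := exists_norm_vecLp_trigLp_le hp hp
  have hp0 : 0 < p := by linarith
  have h (c : ℤ →₀ ℂ) : ‖trigLp (ENNReal.ofReal p) (fun n => if 0 ≤ n then 1 else 0) c‖ ≤
      C * ‖trigLp (ENNReal.ofReal p) (fun _ => 1) c‖ := by
    have h1 := norm_vecLp_one hp0 (trigLp (ENNReal.ofReal p) (fun n => if 0 ≤ n then 1 else 0) c)
    have h2 := norm_vecLp_one hp0 (trigLp (ENNReal.ofReal p) (fun _ => 1) c)
    exact (h1.symm.le.trans (hC 1 fun _ => c)).trans_eq (congrArg _ h2)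
  have h' := LinearMap.extendOfNorm_eq
    (f := trigLp (ENNReal.ofReal p) fun n => if 0 ≤ n then 1 else 0)
    (e := trigLp (ENNReal.ofReal p) fun _ => 1) (denseRange_trigLp ENNReal.ofReal_ne_top) ⟨C, h⟩ c
  rw [rieszLp, h']

theorem fourierCoeff_rieszLp {p : ℝ} (hp : 1 < p) [Fact (1 ≤ ENNReal.ofReal p)]
    (f : Lp ℂ (ENNReal.ofReal p) μ𝕋) (n : ℤ) :
    fourierCoeff (rieszLp _ f) n = if 0 ≤ n then fourierCoeff f n else 0 := by
  refine (denseRange_trigLp ENNReal.ofReal_ne_top).induction_on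
    (p := fun f : Lp ℂ (ENNReal.ofReal p) μ𝕋 =>
      fourierCoeff (rieszLp _ f) n = if 0 ≤ n then fourierCoeff f n else 0) f ?_ fun c => ?_
  · refine isClosed_eq ((continuous_fourierCoeff n).comp (rieszLp _).continuous) ?_
    split_ifs
    · exact continuous_fourierCoeff n
    · exact continuous_const
  · rw [rieszLp_trigLp hp, fourierCoeff_trigLp, fourierCoeff_trigLp]
    split_ifs <;> simp

theorem exists_norm_vecLp_rieszLp_le {p q : ℝ} (hp : 1 < p) (hq : 1 < q)
    [Fact (1 ≤ ENNReal.ofReal p)] [Fact (1 ≤ ENNReal.ofReal q)] :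
    ∃ C : ℝ≥0, ∀ (d : ℕ) (u : Fin d → Lp ℂ (ENNReal.ofReal p) μ𝕋),
      ‖vecLp (ENNReal.ofReal p) (ENNReal.ofReal q) d fun k => rieszLp _ (u k)‖ ≤
        C * ‖vecLp (ENNReal.ofReal p) (ENNReal.ofReal q) d u‖ := by
  obtain ⟨C, hC⟩ := exists_norm_vecLp_trigLp_le hp hq
  refine ⟨C, fun d u => ?_⟩
  refine (DenseRange.piMap fun _ : Fin d => denseRange_trigLp (p := ENNReal.ofReal p)
    ENNReal.ofReal_ne_top).induction_on (p := fun u : Fin d → Lp ℂ (ENNReal.ofReal p) μ𝕋 =>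
      ‖vecLp (ENNReal.ofReal p) (ENNReal.ofReal q) d fun k => rieszLp _ (u k)‖ ≤
        C * ‖vecLp (ENNReal.ofReal p) (ENNReal.ofReal q) d u‖) u ?_ fun c => ?_
  · exact isClosed_le (by fun_prop) (by fun_prop)
  · simp only [Pi.map_apply, rieszLp_trigLp hp]
    exact hC d c

section

variable {p q : ℝ}

theorem eLpLqNorm_rpow (hp : 0 < p) (f : ℕ → 𝕋 → ℂ) :
    eLpLqNorm p q f ^ p = ∫⁻ x, (∑' k, ‖f k x‖ₑ ^ q) ^ (p / q) ∂μ𝕋 := by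
  rw [eLpLqNorm, ← ENNReal.rpow_mul, one_div_mul_cancel hp.ne', ENNReal.rpow_one]
  refine lintegral_congr fun x => ?_
  rw [← ENNReal.rpow_mul, one_div_mul_eq_div]
  rfl

theorem eLpLqNorm_congr_ae {f g : ℕ → 𝕋 → ℂ} (h : ∀ k, f k =ᵐ[μ𝕋] g k) :
    eLpLqNorm p q f = eLpLqNorm p q g := by
  rw [eLpLqNorm, eLpLqNorm]
  congr 1
  refine lintegral_congr_ae ?_
  filter_upwards [ae_all_iff.2 h] with x hx
  simp only [hx]

theorem MemHpLq.congr_ae {f g : ℕ → 𝕋 → ℂ} (hf : MemHpLq p q f) (h : ∀ k, f k =ᵐ[μ𝕋] g k) :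
    MemHpLq p q g :=
  ⟨⟨fun k => (hf.1.1 k).congr (h k), eLpLqNorm_congr_ae (p := p) (q := q) h ▸ hf.1.2⟩,
    fun k n hn => by rw [← fourierCoeff_congr_ae (h k), hf.2 k n hn]⟩

theorem MemLpLq.memLp (hp : 0 < p) (hq : 0 < q) {f : ℕ → 𝕋 → ℂ} (hf : MemLpLq p q f) (k : ℕ) :
    MemLp (f k) (ENNReal.ofReal p) μ𝕋 := by
  refine ⟨hf.1 k, ?_⟩
  rw [eLpNorm_lt_top_iff_lintegral_rpow_enorm_lt_top (by simpa using hp) ENNReal.ofReal_ne_top,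
    ENNReal.toReal_ofReal hp.le]
  refine lt_of_le_of_lt ?_ ((eLpLqNorm_rpow hp f).symm.trans_lt
    (ENNReal.rpow_lt_top_of_nonneg hp.le hf.2.ne))
  refine lintegral_mono fun x => ?_
  calc ‖f k x‖ₑ ^ p = (‖f k x‖ₑ ^ q) ^ (p / q) := by
        rw [← ENNReal.rpow_mul, mul_div_cancel₀ _ hq.ne']
    _ ≤ _ := by
        gcongr
        exact ENNReal.le_tsum k

/-- The Riesz projection is bounded from `L^p(ℓ_q)` to `H^p(ℓ_q)`. -/
theorem exists_rieszProjection (hp : 1 < p) (hq : 1 < q) :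
    ∃ C : ℝ≥0, ∀ f : ℕ → 𝕋 → ℂ, MemLpLq p q f → ∃ g, MemHpLq p q g ∧
      eLpLqNorm p q g ≤ C * eLpLqNorm p q f ∧
      ∀ k n, 0 ≤ n → fourierCoeff (g k) n = fourierCoeff (f k) n := by
  have := one_le_ofReal_fact hp
  have := one_le_ofReal_fact hq
  have hp0 : 0 < p := by linarith
  have hq0 : 0 < q := by linarith
  obtain ⟨C, hC⟩ := exists_norm_vecLp_rieszLp_le hp hq
  refine ⟨C, fun f hf => ?_⟩
  have hm := hf.memLp hp0 hq0
  let u : ℕ → Lp ℂ (ENNReal.ofReal p) μ𝕋 := fun k => (hm k).toLp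
  let v : ℕ → Lp ℂ (ENNReal.ofReal p) μ𝕋 := fun k => rieszLp _ (u k)
  have hfin (d : ℕ) : ∫⁻ x, (∑ k ∈ Finset.range d, ‖v k x‖ₑ ^ q) ^ (p / q) ∂μ𝕋 ≤
      (C * eLpLqNorm p q f) ^ p := by
    have h1 : ‖vecLp (ENNReal.ofReal p) (ENNReal.ofReal q) d fun k => v k‖ₑ ^ p ≤
        (C * ‖vecLp (ENNReal.ofReal p) (ENNReal.ofReal q) d fun k => u k‖ₑ) ^ p := by
      refine ENNReal.rpow_le_rpow ?_ hp0.le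
      have h : ‖vecLp (ENNReal.ofReal p) (ENNReal.ofReal q) d fun k => v k‖₊ ≤
          C * ‖vecLp (ENNReal.ofReal p) (ENNReal.ofReal q) d fun k => u k‖₊ := hC d fun k => u k
      exact (ENNReal.coe_le_coe.2 h).trans_eq (ENNReal.coe_mul _ _)
    rw [ENNReal.mul_rpow_of_nonneg _ _ hp0.le, enorm_vecLp_rpow hp0 hq0,
      enorm_vecLp_rpow hp0 hq0] at h1
    have hs (w : ℕ → Lp ℂ (ENNReal.ofReal p) μ𝕋) (x : 𝕋) :
        ∑ k : Fin d, ‖w k x‖ₑ ^ q = ∑ k ∈ Finset.range d, ‖w k x‖ₑ ^ q :=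
      Fin.sum_univ_eq_sum_range (fun k => ‖w k x‖ₑ ^ q) d
    simp only [hs] at h1
    refine h1.trans ?_
    rw [ENNReal.mul_rpow_of_nonneg _ _ hp0.le, eLpLqNorm_rpow hp0]
    refine mul_le_mul' le_rfl (lintegral_mono_ae ?_)
    filter_upwards [ae_all_iff.2 fun k => (hm k).coeFn_toLp] with x hx
    simp only [u, hx]
    gcongr
    exact ENNReal.sum_le_tsum _
  have hle : eLpLqNorm p q (fun k => v k) ≤ C * eLpLqNorm p q f := by
    rw [← ENNReal.rpow_le_rpow_iff hp0, eLpLqNorm_rpow hp0]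
    have hs (x : 𝕋) : (∑' k, ‖v k x‖ₑ ^ q) ^ (p / q) =
        ⨆ d, (∑ k ∈ Finset.range d, ‖v k x‖ₑ ^ q) ^ (p / q) := by
      rw [ENNReal.tsum_eq_iSup_nat]
      exact (ENNReal.orderIsoRpow (p / q) (by positivity)).map_iSup _
    simp only [hs]
    rw [lintegral_iSup']
    · exact iSup_le hfin
    · intro d
      have (k : ℕ) := (Lp.aestronglyMeasurable (v k)).enorm
      fun_prop
    · refine Filter.Eventually.of_forall fun x d d' hd => ?_
      dsimp only
      gcongr
  refine ⟨fun k => v k, ⟨⟨fun k => Lp.aestronglyMeasurable _, hle.trans_lt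
    (ENNReal.mul_lt_top ENNReal.coe_lt_top hf.2)⟩, fun k n hn => ?_⟩, hle, fun k n hn => ?_⟩
  · rw [fourierCoeff_rieszLp hp, if_neg hn.not_ge]
  · rw [fourierCoeff_rieszLp hp, if_pos hn, fourierCoeff_congr_ae (hm k).coeFn_toLp]

end

theorem fourierCoeff_add_memLp {p q : ℝ≥0∞} (hp : 1 ≤ p) (hq : 1 ≤ q) {f g : 𝕋 → ℂ}
    (hf : MemLp f p μ𝕋) (hg : MemLp g q μ𝕋) (n : ℤ) :
    fourierCoeff (f + g) n = fourierCoeff f n + fourierCoeff g n := by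
  rw [fourierCoeff.add (hf.integrable hp) (hg.integrable hq), Pi.add_apply]

theorem Kfunctional_le {t : ℝ≥0∞} {X₀ X₁ : (ℕ → 𝕋 → ℂ) → Prop}
    {N₀ N₁ : (ℕ → 𝕋 → ℂ) → ℝ≥0∞} {f g₀ g₁ : ℕ → 𝕋 → ℂ} (h₀ : X₀ g₀) (h₁ : X₁ g₁)
    (h : f = g₀ + g₁) : Kfunctional t X₀ X₁ N₀ N₁ f ≤ N₀ g₀ + t * N₁ g₁ :=
  iInf₂_le_of_le g₀ g₁ <| iInf₂_le_of_le h₀ h₁ <| iInf_le _ h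

/-- **Remark**: for all exponents `1 < p₀, p₁, q₀, q₁ < ∞` there is a constant `C` such that
for every `f` decomposable as `a + b` with `a ∈ H^{p₀}(ℓ_{q₀})`, `b ∈ H^{p₁}(ℓ_{q₁})` and
every `t > 0`,
`K_t(f; H^{p₀}(ℓ_{q₀}), H^{p₁}(ℓ_{q₁})) ≤ C · K_t(f; L^{p₀}(ℓ_{q₀}), L^{p₁}(ℓ_{q₁}))`. -/
theorem K_functional_Hp_couple (p₀ p₁ q₀ q₁ : ℝ)
    (hp₀ : 1 < p₀) (hp₁ : 1 < p₁) (hq₀ : 1 < q₀) (hq₁ : 1 < q₁) :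
    ∃ C : ℝ≥0, 0 < C ∧
      ∀ f : ℕ → 𝕋 → ℂ,
        (∃ a b : ℕ → 𝕋 → ℂ, MemHpLq p₀ q₀ a ∧ MemHpLq p₁ q₁ b ∧ f = a + b) →
        ∀ t : ℝ, 0 < t →
          Kfunctional (ENNReal.ofReal t) (MemHpLq p₀ q₀) (MemHpLq p₁ q₁)
              (eLpLqNorm p₀ q₀) (eLpLqNorm p₁ q₁) f ≤
            C * Kfunctional (ENNReal.ofReal t) (MemLpLq p₀ q₀) (MemLpLq p₁ q₁)
              (eLpLqNorm p₀ q₀) (eLpLqNorm p₁ q₁) f := by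
  obtain ⟨C₀, hC₀⟩ := exists_rieszProjection hp₀ hq₀
  obtain ⟨C₁, hC₁⟩ := exists_rieszProjection hp₁ hq₁
  have hC : (0 : ℝ≥0) < C₀ + C₁ + 1 := by positivity
  refine ⟨C₀ + C₁ + 1, hC, ?_⟩
  rintro f ⟨a, b, ha, hb, rfl⟩ t -
  have hC0 : ((C₀ + C₁ + 1 : ℝ≥0) : ℝ≥0∞) ≠ 0 := by exact_mod_cast hC.ne'
  rw [mul_comm, ← ENNReal.div_le_iff_le_mul (.inl hC0) (.inl ENNReal.coe_ne_top)]
  refine le_iInf fun g₀ => le_iInf fun g₁ => le_iInf fun hg₀ => le_iInf fun hg₁ =>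
    le_iInf fun hg => ?_
  rw [ENNReal.div_le_iff_le_mul (.inl hC0) (.inl ENNReal.coe_ne_top), mul_comm]
  obtain ⟨h₀, hh₀, hn₀, hf₀⟩ := hC₀ g₀ hg₀
  obtain ⟨h₁, hh₁, hn₁, hf₁⟩ := hC₁ g₁ hg₁
  have lp₀ {u : ℕ → 𝕋 → ℂ} (hu : MemLpLq p₀ q₀ u) (k : ℕ) :=
    hu.memLp (by linarith) (by linarith) k
  have lp₁ {u : ℕ → 𝕋 → ℂ} (hu : MemLpLq p₁ q₁ u) (k : ℕ) :=
    hu.memLp (by linarith) (by linarith) k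
  have e₀ := ENNReal.one_lt_ofReal.2 hp₀
  have e₁ := ENNReal.one_lt_ofReal.2 hp₁
  have hr : 1 < min (ENNReal.ofReal p₀) (ENNReal.ofReal p₁) := lt_min e₀ e₁
  have : Fact (1 ≤ min (ENNReal.ofReal p₀) (ENNReal.ofReal p₁)) := ⟨hr.le⟩
  have key (k : ℕ) : a k + b k =ᵐ[μ𝕋] h₀ k + h₁ k := by
    refine ae_eq_of_fourierCoeff_eq hr
      (((lp₀ ha.1 k).mono_exponent (min_le_left _ _)).add
        ((lp₁ hb.1 k).mono_exponent (min_le_right _ _)))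
      (((lp₀ hh₀.1 k).mono_exponent (min_le_left _ _)).add
        ((lp₁ hh₁.1 k).mono_exponent (min_le_right _ _))) fun n => ?_
    rw [fourierCoeff_add_memLp e₀.le e₁.le (lp₀ hh₀.1 k) (lp₁ hh₁.1 k)]
    obtain hn | hn := lt_or_ge n 0
    · rw [fourierCoeff_add_memLp e₀.le e₁.le (lp₀ ha.1 k) (lp₁ hb.1 k), ha.2 k n hn, hb.2 k n hn,
        hh₀.2 k n hn, hh₁.2 k n hn]
    · rw [hf₀ k n hn, hf₁ k n hn,
        ← fourierCoeff_add_memLp e₀.le e₁.le (lp₀ hg₀ k) (lp₁ hg₁ k)]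
      exact congrArg (fun u : ℕ → 𝕋 → ℂ => fourierCoeff (u k) n) hg
  have key' (k : ℕ) : h₁ k =ᵐ[μ𝕋] (a + b - h₀) k := by
    filter_upwards [key k] with x hx
    simp only [Pi.sub_apply, Pi.add_apply] at hx ⊢
    rw [hx, add_sub_cancel_left]
  refine (Kfunctional_le hh₀ (hh₁.congr_ae key') (add_sub_cancel _ _).symm).trans ?_
  rw [← eLpLqNorm_congr_ae key', mul_add, mul_left_comm]
  gcongr
  · refine hn₀.trans ?_
    gcongr
    exact_mod_cast (by rw [add_assoc]; exact le_self_add : C₀ ≤ C₀ + C₁ + 1)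
  · refine hn₁.trans ?_
    gcongr
    exact_mod_cast (by rw [add_right_comm]; exact le_add_self : C₁ ≤ C₀ + C₁ + 1)
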